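/- There exists a finite graph G such that α_q(G) < α_qa(G). -/

import Mathlib

open Matrix

noncomputable section

/-- The set of quantum correlations with input set `I` and output set `O`:
`p x y a b` is the probability of outputs `(a,b)` on inputs `(x,y)`, realised by
finite-dimensional PVMs `E`, `F` and a unit vector `ψ` in the tensor product
(Kronecker) Hilbert space. -/
def QCorr (I O : Type) [Fintype I] [Fintype O] : Set (I → I → O → O → ℝ) :=
  {p | ∃ dA dB : ℕ, 0 < dA ∧ 0 < dB ∧
    ∃ (E : I → O → Matrix (Fin dA) (Fin dA) ℂ)
      (F : I → O → Matrix (Fin dB) (Fin dB) ℂ)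
      (ψ : Fin dA × Fin dB → ℂ),
      (∀ x a, (E x a).IsHermitian ∧ E x a * E x a = E x a) ∧
      (∀ x, ∑ a, E x a = 1) ∧
      (∀ y b, (F y b).IsHermitian ∧ F y b * F y b = F y b) ∧
      (∀ y, ∑ b, F y b = 1) ∧
      star ψ ⬝ᵥ ψ = 1 ∧
      (∀ x y a b, (p x y a b : ℂ) =
        star ψ ⬝ᵥ (Matrix.kroneckerMap (· * ·) (E x a) (F y b)).mulVec ψ) }

/-- A game (described by its losing-tuple predicate `lose`: `lose x y a b` means
`λ(x,y,a,b) = 0`) has a perfect q-strategy. -/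
def PerfectQ {I O : Type} [Fintype I] [Fintype O]
    (lose : I → I → O → O → Prop) : Prop :=
  ∃ p ∈ QCorr I O, ∀ x y a b, lose x y a b → p x y a b = 0

/-- A game has a perfect qa-strategy: a correlation in the closure of `QCorr`
vanishing on losing tuples. -/
def PerfectQA {I O : Type} [Fintype I] [Fintype O]
    (lose : I → I → O → O → Prop) : Prop :=
  ∃ p ∈ closure (QCorr I O), ∀ x y a b, lose x y a b → p x y a b = 0

/-- The losing tuples of the independence game for a graph `G` with `c` inputs:
on inputs `(i,j)` and outputs `(v,w)`, the players lose iff (`i = j` and `v ≠ w`) or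
(`i ≠ j` and (`v = w` or `v ∼ w`)). -/
def indepLose {V : Type} (G : SimpleGraph V) (c : ℕ) :
    Fin c → Fin c → V → V → Prop :=
  fun i j v w => (i = j ∧ v ≠ w) ∨ (i ≠ j ∧ (v = w ∨ G.Adj v w))

/-- The quantum independence number `α_q(G)`: the largest `c` for which the
independence game has a perfect q-strategy. -/
def alphaQ {V : Type} [Fintype V] (G : SimpleGraph V) : ℕ :=
  sSup {c : ℕ | PerfectQ (indepLose G c)}

/-- The quantum approximate independence number `α_qa(G)`. -/
def alphaQA {V : Type} [Fintype V] (G : SimpleGraph V) : ℕ :=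
  sSup {c : ℕ | PerfectQA (indepLose G c)}

/-- The losing tuples of the `d`-coloring game for a graph `G`. -/
def colorLose {V : Type} (G : SimpleGraph V) (d : ℕ) :
    V → V → Fin d → Fin d → Prop :=
  fun v w i j => (v = w ∧ i ≠ j) ∨ (G.Adj v w ∧ i = j)

/-- The quantum chromatic number `χ_q(G)`: the least `d` for which the `d`-coloring
game has a perfect q-strategy. -/
def chiQ {V : Type} [Fintype V] (G : SimpleGraph V) : ℕ :=
  sInf {d : ℕ | PerfectQ (colorLose G d)}

/-- The quantum approximate chromatic number `χ_qa(G)`. -/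
def chiQA {V : Type} [Fintype V] (G : SimpleGraph V) : ℕ :=
  sInf {d : ℕ | PerfectQA (colorLose G d)}

/-- `rel(g,g') = rel(h,h')` for vertices `g, g'` of `G` and `h, h'` of `H`. -/
def relSame {VG VH : Type} (G : SimpleGraph VG) (H : SimpleGraph VH)
    (g g' : VG) (h h' : VH) : Prop :=
  (g = g' ∧ h = h') ∨ (G.Adj g g' ∧ H.Adj h h') ∨
    (g ≠ g' ∧ ¬ G.Adj g g' ∧ h ≠ h' ∧ ¬ H.Adj h h')

/-- Pair an input and an output of the `(G,H)`-isomorphism game into an element of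
`V(G) × V(H)`, provided the output lies in the opposite graph from the input
(otherwise `none`). -/
def pairIO {VG VH : Type} : (VG ⊕ VH) → (VG ⊕ VH) → Option (VG × VH)
  | Sum.inl g, Sum.inr h => some (g, h)
  | Sum.inr h, Sum.inl g => some (g, h)
  | _, _ => none

/-- The losing tuples of the `(G,H)`-isomorphism game: the players win iff each
output is in the opposite graph from the corresponding input and, for the resulting
pairs `(g_A, h_A)`, `(g_B, h_B)`, one has `rel(g_A,g_B) = rel(h_A,h_B)`. -/
def isoLose {VG VH : Type} (G : SimpleGraph VG) (H : SimpleGraph VH) :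
    (VG ⊕ VH) → (VG ⊕ VH) → (VG ⊕ VH) → (VG ⊕ VH) → Prop :=
  fun xA xB aA aB =>
    ¬ ∃ (gA : VG) (hA : VH) (gB : VG) (hB : VH),
        pairIO xA aA = some (gA, hA) ∧ pairIO xB aB = some (gB, hB) ∧
        relSame G H gA gB hA hB

/-- `G ≅_q H`: the `(G,H)`-isomorphism game has a perfect q-strategy. -/
def QIso {VG VH : Type} [Fintype VG] [Fintype VH]
    (G : SimpleGraph VG) (H : SimpleGraph VH) : Prop :=
  PerfectQ (isoLose G H)

/-- `G ≅_qa H`: the `(G,H)`-isomorphism game has a perfect qa-strategy. -/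
def QAIso {VG VH : Type} [Fintype VG] [Fintype VH]
    (G : SimpleGraph VG) (H : SimpleGraph VH) : Prop :=
  PerfectQA (isoLose G H)

/-! ### Part 1: generic facts on quantum correlations -/

lemma kron_form {m n : ℕ} (E : Matrix (Fin m) (Fin m) ℂ) (F : Matrix (Fin n) (Fin n) ℂ)
    (ψ : Fin m × Fin n → ℂ) (Ψ : Matrix (Fin m) (Fin n) ℂ) (h : ∀ a b, Ψ a b = ψ (a, b)) :
    star ψ ⬝ᵥ (Matrix.kroneckerMap (· * ·) E F).mulVec ψ = (Ψᴴ * E * Ψ * Fᵀ).trace := by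
  have h1 : ∀ a b, (Matrix.kroneckerMap (· * ·) E F).mulVec ψ (a, b) = (E * Ψ * Fᵀ) a b := by
    intro a b
    simp only [dotProduct, mulVec, Matrix.mul_apply, Fintype.sum_prod_type,
      Matrix.kroneckerMap_apply, Matrix.transpose_apply, h, Finset.sum_mul]
    rw [Finset.sum_comm]
    refine Finset.sum_congr rfl fun y _ => Finset.sum_congr rfl fun x _ => ?_
    ring
  rw [Matrix.mul_assoc, Matrix.mul_assoc, ← Matrix.mul_assoc E]
  simp only [dotProduct, Matrix.trace, Matrix.diag, Fintype.sum_prod_type, h1]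
  rw [Finset.sum_comm]
  refine Finset.sum_congr rfl fun y _ => ?_
  rw [Matrix.mul_apply]
  simp [h]

open scoped ComplexOrder in
lemma lose_zero {m n : ℕ} (E : Matrix (Fin m) (Fin m) ℂ) (F : Matrix (Fin n) (Fin n) ℂ)
    (Ψ : Matrix (Fin m) (Fin n) ℂ) (hE : E.IsHermitian) (hE2 : E * E = E)
    (hF : F.IsHermitian) (hF2 : F * F = F) (h : (Ψᴴ * E * Ψ * Fᵀ).trace = 0) :
    E * Ψ * Fᵀ = 0 := by
  rw [← Matrix.trace_conjTranspose_mul_self_eq_zero_iff, ← h]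
  have h1 : (Fᵀ)ᴴ = Fᵀ := hF.transpose
  have h2 : Fᵀ * Fᵀ = Fᵀ := by rw [← Matrix.transpose_mul, hF2]
  rw [Matrix.conjTranspose_mul, Matrix.conjTranspose_mul, h1, hE.eq, Matrix.trace_mul_comm]
  have : E * Ψ * Fᵀ * (Fᵀ * (Ψᴴ * E)) = E * (Ψ * (Fᵀ * Fᵀ) * Ψᴴ * E) := by
    simp only [Matrix.mul_assoc]
  rw [this, h2, Matrix.trace_mul_comm]
  have : Ψ * Fᵀ * Ψᴴ * E * E = (Ψ * Fᵀ) * (Ψᴴ * (E * E)) := by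
    simp only [Matrix.mul_assoc]
  rw [this, hE2, Matrix.trace_mul_comm, Matrix.mul_assoc _ Ψ]

lemma algRep {I O : Type} [Fintype I] [Fintype O] (lose : I → I → O → O → Prop)
    (hsync : ∀ x a b, a ≠ b → lose x x a b) (h : PerfectQ lose) :
    ∃ (W : Type) (_ : AddCommGroup W) (_ : Module ℂ W) (_ : FiniteDimensional ℂ W)
      (_ : Nontrivial W) (e : I → O → Module.End ℂ W),
      (∀ x, ∑ a, e x a = 1) ∧ ∀ x y a b, lose x y a b → e x a * e y b = 0 := by
  classical
  obtain ⟨p, ⟨dA, dB, -, -, E, F, ψ, hE, hE1, hF, hF1, hψ, hp⟩, hl⟩ := h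
  set Ψ : Matrix (Fin dA) (Fin dB) ℂ := Matrix.of fun a b => ψ (a, b) with hΨ
  have hz : ∀ x y a b, lose x y a b → E x a * Ψ * (F y b)ᵀ = 0 := by
    intro x y a b hlo
    apply lose_zero _ _ _ (hE x a).1 (hE x a).2 (hF y b).1 (hF y b).2
    rw [← kron_form _ _ ψ Ψ (fun _ _ => rfl), ← hp, hl _ _ _ _ hlo]; simp
  have hF1' : ∀ y, ∑ b, (F y b)ᵀ = 1 := by
    intro y; rw [← Matrix.transpose_sum, hF1, Matrix.transpose_one]
  have hs : ∀ x a, E x a * Ψ = Ψ * (F x a)ᵀ := by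
    intro x a
    have h1 : E x a * Ψ = E x a * Ψ * (F x a)ᵀ := by
      conv_lhs => rw [← Matrix.mul_one (E x a * Ψ), ← hF1' x, Matrix.mul_sum]
      exact Finset.sum_eq_single a (fun b _ hb => hz _ _ _ _ (hsync _ _ _ (Ne.symm hb))) (by simp)
    have h2 : Ψ * (F x a)ᵀ = E x a * Ψ * (F x a)ᵀ := by
      conv_lhs => rw [← Matrix.one_mul (Ψ * (F x a)ᵀ), ← hE1 x, Matrix.sum_mul]
      rw [Finset.sum_eq_single a (fun b _ hb => by
        rw [← Matrix.mul_assoc]; exact hz _ _ _ _ (hsync _ _ _ hb)) (by simp), Matrix.mul_assoc]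
    rw [h1, ← h2]
  have hz2 : ∀ x y a b, lose x y a b → E x a * (E y b * Ψ) = 0 := by
    intro x y a b hlo
    rw [hs, ← Matrix.mul_assoc, hz _ _ _ _ hlo]
  have hinv : ∀ x a, ∀ v ∈ LinearMap.range Ψ.mulVecLin,
      (E x a).mulVecLin v ∈ LinearMap.range Ψ.mulVecLin := by
    rintro x a _ ⟨u, rfl⟩
    refine ⟨(F x a)ᵀ *ᵥ u, ?_⟩
    simp [hs]
  refine ⟨LinearMap.range Ψ.mulVecLin, inferInstance, inferInstance, inferInstance, ?_,
    fun x a => (E x a).mulVecLin.restrict (hinv x a), ?_, ?_⟩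
  · rw [Submodule.nontrivial_iff_ne_bot]
    intro hb
    rw [LinearMap.range_eq_bot] at hb
    have h0 : ∀ a b, ψ (a, b) = 0 := by
      intro a b
      have := congrFun (LinearMap.congr_fun hb (Pi.single b 1)) a
      simpa [hΨ] using this
    have : ψ = 0 := by ext ⟨a, b⟩; exact h0 a b
    simp [this] at hψ
  · intro x
    ext ⟨v, hv⟩ i
    have := congrArg (fun M => (M *ᵥ v) i) (hE1 x)
    simpa [Matrix.sum_mulVec] using this
  · intro x y a b hlo
    ext ⟨v, u, rfl⟩ i
    have := congrArg (fun M => (M *ᵥ u) i) (hz2 x y a b hlo)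
    simpa using this

lemma perfectQ_mono {V : Type} [Fintype V] (G : SimpleGraph V) {c d : ℕ} (hcd : c ≤ d)
    (h : PerfectQ (indepLose G d)) : PerfectQ (indepLose G c) := by
  obtain ⟨p, ⟨dA, dB, ha, hb, E, F, ψ, hE, hE1, hF, hF1, hψ, hp⟩, hl⟩ := h
  let f := Fin.castLE hcd
  refine ⟨fun x y => p (f x) (f y), ⟨dA, dB, ha, hb, fun x => E (f x), fun x => F (f x), ψ,
    fun x => hE _, fun x => hE1 _, fun x => hF _, fun x => hF1 _, hψ, fun x y => hp _ _⟩, ?_⟩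
  intro x y a b hlo
  apply hl
  have : ∀ x y, f x = f y ↔ x = y := fun x y => (Fin.castLE_injective hcd).eq_iff
  simpa [indepLose, this] using hlo

/-! ### Part 2: the set of `c` with a perfect qa-strategy is bounded -/

lemma inner_ineq {ι V F : Type} [Fintype ι] [Fintype V] [NormedAddCommGroup F]
    [InnerProductSpace ℝ F] (ψ : F) (hψ : ‖ψ‖ = 1) (u w : ι → V → F)
    (hu : ∀ i, ∑ v, u i v = ψ) (hw : ∀ i, ∑ v, w i v = ψ)
    (hu2 : ∀ i, ∑ v, ‖u i v‖ ^ 2 = 1) (hw2 : ∀ i, ∑ v, ‖w i v‖ ^ 2 = 1) :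
    (Fintype.card ι : ℝ) ^ 2 ≤ Fintype.card V * (∑ i, ∑ j, ∑ v, inner ℝ (u i v) (w j v) +
      Fintype.card ι * (Fintype.card ι - ∑ i, ∑ v, inner ℝ (u i v) (w i v))) := by
  set c : ℝ := (Fintype.card ι : ℝ) with hc
  have key : ∀ x : ι → V → F, (∀ i, ∑ v, x i v = ψ) →
      c ^ 2 ≤ Fintype.card V * ∑ v, ‖∑ i, x i v‖ ^ 2 := by
    intro x hx
    have h1 : ∑ v, ∑ i, x i v = c • ψ := by
      rw [Finset.sum_comm, Finset.sum_congr rfl fun i _ => hx i]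
      simp [hc, Finset.card_univ, Nat.cast_smul_eq_nsmul]
    have h2 : c ≤ ∑ v, ‖∑ i, x i v‖ := by
      have : ‖∑ v, ∑ i, x i v‖ = c := by rw [h1, norm_smul, hψ]; simp [hc]
      rw [← this]; exact norm_sum_le _ _
    calc c ^ 2 ≤ (∑ v, ‖∑ i, x i v‖) ^ 2 := by gcongr
      _ ≤ _ := by
        have := sq_sum_le_card_mul_sum_sq (s := (Finset.univ : Finset V))
          (f := fun v => ‖∑ i, x i v‖)
        simpa [Finset.card_univ] using this
  have hU := key u hu
  have hW := key w hw
  have hD : ∑ v, ‖∑ i, u i v - ∑ i, w i v‖ ^ 2 ≤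
      c * (2 * c - 2 * ∑ i, ∑ v, inner ℝ (u i v) (w i v)) := by
    have h1 : ∀ v, ‖∑ i, u i v - ∑ i, w i v‖ ^ 2 ≤ c * ∑ i, ‖u i v - w i v‖ ^ 2 := by
      intro v
      rw [← Finset.sum_sub_distrib]
      calc _ ≤ (∑ i, ‖u i v - w i v‖) ^ 2 := by gcongr; exact norm_sum_le _ _
        _ ≤ _ := by
          have := sq_sum_le_card_mul_sum_sq (s := (Finset.univ : Finset ι))
            (f := fun i => ‖u i v - w i v‖)
          simpa [Finset.card_univ] using this
    calc _ ≤ ∑ v, c * ∑ i, ‖u i v - w i v‖ ^ 2 := Finset.sum_le_sum fun v _ => h1 v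
      _ = c * ∑ i, ∑ v, ‖u i v - w i v‖ ^ 2 := by
        rw [← Finset.mul_sum, Finset.sum_comm]
      _ = _ := by
        congr 1
        simp only [norm_sub_sq_real, Finset.sum_add_distrib, Finset.sum_sub_distrib, hu2, hw2,
          ← Finset.mul_sum]
        simp [hc]; ring
  have hI : ∑ i, ∑ j, ∑ v, inner ℝ (u i v) (w j v) =
      ∑ v, inner ℝ (∑ i, u i v) (∑ i, w i v) := by
    simp only [sum_inner, inner_sum]
    conv_rhs => rw [Finset.sum_comm]; enter [2, i]; rw [Finset.sum_comm]
    exact Finset.sum_comm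
    
  have hE : ∑ v, ‖∑ i, u i v - ∑ i, w i v‖ ^ 2 = ∑ v, ‖∑ i, u i v‖ ^ 2 +
      ∑ v, ‖∑ i, w i v‖ ^ 2 - 2 * ∑ v, inner ℝ (∑ i, u i v) (∑ i, w i v) := by
    simp only [norm_sub_sq_real, Finset.sum_add_distrib, Finset.sum_sub_distrib,
          ← Finset.mul_sum]
    ring
  rw [hI]
  have hV : (0 : ℝ) ≤ Fintype.card V := by positivity
  nlinarith [mul_le_mul_of_nonneg_left hD hV]

lemma qcorr_ineq {I O : Type} [Fintype I] [Fintype O] (p : I → I → O → O → ℝ)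
    (hp : p ∈ QCorr I O) :
    (∀ i, ∑ a, ∑ b, p i i a b = 1) ∧
    (Fintype.card I : ℝ) ^ 2 ≤ Fintype.card O * (∑ i, ∑ j, ∑ v, p i j v v +
      Fintype.card I * (Fintype.card I - ∑ i, ∑ v, p i i v v)) := by
  obtain ⟨dA, dB, -, -, E, F, ψ, hE, hE1, hF, hF1, hψ, hp⟩ := hp
  set Ψ : Matrix (Fin dA) (Fin dB) ℂ := Matrix.of fun a b => ψ (a, b) with hΨ
  let _ := InnerProductSpace.rclikeToReal ℂ (EuclideanSpace ℂ (Fin dA × Fin dB))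
  let vc : Matrix (Fin dA) (Fin dB) ℂ → EuclideanSpace ℂ (Fin dA × Fin dB) :=
    fun M => WithLp.toLp 2 fun x => M x.1 x.2
  have vsum : ∀ (f : O → Matrix (Fin dA) (Fin dB) ℂ), ∑ v, vc (f v) = vc (∑ v, f v) := by
    intro f; ext x; simp [vc, Matrix.sum_apply]
  have vin : ∀ A B, inner ℝ (vc A) (vc B) = (Aᴴ * B).trace.re := by
    intro A B
    rw [real_inner_eq_re_inner ℂ]
    simp only [PiLp.inner_apply, vc, Matrix.trace, Matrix.diag, Matrix.mul_apply, Fintype.sum_prod_type]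
    rw [Finset.sum_comm]
    simp [mul_comm]
  have hpp : ∀ x y a b, (p x y a b : ℂ) = (Ψᴴ * E x a * Ψ * (F y b)ᵀ).trace := by
    intro x y a b
    rw [hp, kron_form _ _ ψ Ψ (fun _ _ => rfl)]
  have hF1' : ∀ y, ∑ b, (F y b)ᵀ = 1 := by
    intro y; rw [← Matrix.transpose_sum, hF1, Matrix.transpose_one]
  have h1 : (Ψᴴ * Ψ).trace = 1 := by
    rw [← hψ]
    simp only [Matrix.trace, Matrix.diag, Matrix.mul_apply, dotProduct, Fintype.sum_prod_type]
    rw [Finset.sum_comm]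
    simp [hΨ]
  have hinn : ∀ i j v w, inner ℝ (vc (E i v * Ψ)) (vc (Ψ * (F j w)ᵀ)) = p i j v w := by
    intro i j v w
    rw [vin, Matrix.conjTranspose_mul, (hE i v).1.eq, ← Matrix.mul_assoc, ← hpp]
    simp
  have hone : inner ℝ (vc Ψ) (vc Ψ) = (1 : ℝ) := by rw [vin, h1]; simp
  have hu2 : ∀ i, ∑ v, ‖vc (E i v * Ψ)‖ ^ 2 = 1 := by
    intro i
    have : ∀ v, ‖vc (E i v * Ψ)‖ ^ 2 = inner ℝ (vc Ψ) (vc (E i v * Ψ)) := by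
      intro v
      rw [← real_inner_self_eq_norm_sq, vin, vin, Matrix.conjTranspose_mul, (hE i v).1.eq,
        Matrix.mul_assoc, ← Matrix.mul_assoc (E i v), (hE i v).2]
    simp only [this]
    rw [← inner_sum, vsum, ← Matrix.sum_mul, hE1, Matrix.one_mul, hone]
  have hw2 : ∀ i, ∑ v, ‖vc (Ψ * (F i v)ᵀ)‖ ^ 2 = 1 := by
    intro i
    have : ∀ v, ‖vc (Ψ * (F i v)ᵀ)‖ ^ 2 = inner ℝ (vc Ψ) (vc (Ψ * (F i v)ᵀ)) := by
      intro v
      have h1 : ((F i v)ᵀ)ᴴ = (F i v)ᵀ := (hF i v).1.transpose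
      have h2 : (F i v)ᵀ * (F i v)ᵀ = (F i v)ᵀ := by rw [← Matrix.transpose_mul, (hF i v).2]
      rw [← real_inner_self_eq_norm_sq, vin, vin, Matrix.conjTranspose_mul, h1,
        Matrix.trace_mul_comm, ← Matrix.mul_assoc, Matrix.mul_assoc Ψ, h2, Matrix.trace_mul_comm]
    simp only [this]
    rw [← inner_sum, vsum, ← Matrix.mul_sum, hF1', Matrix.mul_one, hone]
  have hus : ∀ i, ∑ v, vc (E i v * Ψ) = vc Ψ := by
    intro i; rw [vsum, ← Matrix.sum_mul, hE1, Matrix.one_mul]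
  have hws : ∀ i, ∑ v, vc (Ψ * (F i v)ᵀ) = vc Ψ := by
    intro i; rw [vsum, ← Matrix.mul_sum, hF1', Matrix.mul_one]
  constructor
  · intro i
    simp only [← hinn, ← inner_sum, ← sum_inner]
    rw [hus, hws, hone]
  · have hn : ‖vc Ψ‖ = 1 := by
      have := real_inner_self_eq_norm_sq (vc Ψ)
      rw [hone] at this
      nlinarith [norm_nonneg (vc Ψ)]
    have := inner_ineq (vc Ψ) hn (fun i v => vc (E i v * Ψ)) (fun i v => vc (Ψ * (F i v)ᵀ))
      hus hws hu2 hw2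
    simpa only [hinn] using this

lemma perfectQA_le {V : Type} [Fintype V] (G : SimpleGraph V) (c : ℕ)
    (h : PerfectQA (indepLose G c)) : c ≤ Fintype.card V := by
  obtain ⟨p, hp, hl⟩ := h
  have hcl : IsClosed {p : Fin c → Fin c → V → V → ℝ | (∀ i, ∑ a, ∑ b, p i i a b = 1) ∧
    (Fintype.card (Fin c) : ℝ) ^ 2 ≤ Fintype.card V * (∑ i, ∑ j, ∑ v, p i j v v +
      Fintype.card (Fin c) * (Fintype.card (Fin c) - ∑ i, ∑ v, p i i v v))} := by
    apply IsClosed.and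
    · simp only [Set.ofPred_forall]
      refine isClosed_iInter fun i => isClosed_eq (by fun_prop) (by fun_prop)
    · exact isClosed_le (by fun_prop) (by fun_prop)
  obtain ⟨h1, h2⟩ := closure_minimal (fun p hp => qcorr_ineq p hp) hcl hp
  have h3 : ∀ i, ∑ v, p i i v v = 1 := by
    intro i
    rw [← h1 i]
    refine Finset.sum_congr rfl fun a _ => ?_
    symm
    refine Finset.sum_eq_single a (fun b _ hb => hl _ _ _ _ (Or.inl ⟨rfl, Ne.symm hb⟩)) (by simp)
  have h4 : ∀ i, ∑ j, ∑ v, p i j v v = 1 := by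
    intro i
    rw [← h3 i]
    refine Finset.sum_eq_single i (fun j _ hj => Finset.sum_eq_zero fun v _ =>
      hl _ _ _ _ (Or.inr ⟨Ne.symm hj, Or.inl rfl⟩)) (by simp)
  simp only [h3, h4] at h2
  simp at h2
  rcases Nat.eq_zero_or_pos c with h0 | h0
  · omega
  · have hc : (0 : ℝ) < c := by exact_mod_cast h0
    have : (c : ℝ) ≤ Fintype.card V := by nlinarith
    exact_mod_cast this

/-! ### Part 3: tracial correlations -/

open scoped ComplexOrder in
lemma trace_proj_nonneg {Ω : Type} [Fintype Ω] [DecidableEq Ω] (A B : Matrix Ω Ω ℂ)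
    (hA : A.IsHermitian) (hA2 : A * A = A) (hB : B.IsHermitian) (hB2 : B * B = B) :
    0 ≤ (A * B).trace.re ∧ ((A * B).trace.re : ℂ) = (A * B).trace := by
  have h1 : (A * B).trace = ((A * B)ᴴ * (A * B)).trace := by
    rw [Matrix.conjTranspose_mul, hA.eq, hB.eq, Matrix.mul_assoc, ← Matrix.mul_assoc A, hA2,
      Matrix.trace_mul_comm B, Matrix.mul_assoc, hB2]
  have h2 : 0 ≤ (A * B).trace := by
    rw [h1]; exact (Matrix.posSemidef_conjTranspose_mul_self (A * B)).trace_nonneg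
  rw [Complex.le_def] at h2
  refine ⟨h2.1, ?_⟩
  apply Complex.ext
  · simp
  · simpa using h2.2

lemma traceCorr {I O Ω : Type} [Fintype I] [Fintype O] [Fintype Ω] [DecidableEq Ω] [Nonempty Ω]
    (E : I → O → Matrix Ω Ω ℂ) (hE : ∀ x a, (E x a).IsHermitian ∧ E x a * E x a = E x a)
    (hE1 : ∀ x, ∑ a, E x a = 1) :
    (fun x y a b => (E x a * E y b).trace.re / Fintype.card Ω) ∈ QCorr I O ∧
    ∀ x y a b, (E x a * E y b).trace.re / Fintype.card Ω ∈ Set.Icc (0 : ℝ) 1 := by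
  classical
  have hN : 0 < Fintype.card Ω := Fintype.card_pos
  have hNr : (0 : ℝ) < Fintype.card Ω := by exact_mod_cast hN
  have hNc : (Fintype.card Ω : ℂ) ≠ 0 := by exact_mod_cast hN.ne'
  have hre : ∀ x y a b, 0 ≤ (E x a * E y b).trace.re ∧
      ((E x a * E y b).trace.re : ℂ) = (E x a * E y b).trace := fun x y a b =>
    trace_proj_nonneg _ _ (hE x a).1 (hE x a).2 (hE y b).1 (hE y b).2
  constructor
  · let f : Fin (Fintype.card Ω) ≃ Ω := (Fintype.equivFin Ω).symm
    let E' : I → O → Matrix (Fin (Fintype.card Ω)) (Fin (Fintype.card Ω)) ℂ :=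
      fun x a => (E x a).submatrix f f
    have hE'2 : ∀ x a, E' x a * E' x a = E' x a := by
      intro x a
      simp only [E']
      rw [Matrix.submatrix_mul_equiv, (hE x a).2]
    have hE'1 : ∀ x, ∑ a, E' x a = 1 := by
      intro x
      have := congrArg (fun M => M.submatrix f f) (hE1 x)
      simp only [Matrix.submatrix_one_equiv] at this
      rw [← this]
      ext i j
      simp [E', Matrix.sum_apply]
    let s : ℂ := ((Real.sqrt (Fintype.card Ω))⁻¹ : ℝ)
    have hs : s * s = (Fintype.card Ω : ℂ)⁻¹ := by
      simp only [s]
      rw [← Complex.ofReal_mul, ← mul_inv, Real.mul_self_sqrt hNr.le]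
      simp
    have hs' : star s = s := by simp [s]
    let ψ : Fin (Fintype.card Ω) × Fin (Fintype.card Ω) → ℂ := fun x =>
      (s • (1 : Matrix (Fin (Fintype.card Ω)) (Fin (Fintype.card Ω)) ℂ)) x.1 x.2
    refine ⟨Fintype.card Ω, Fintype.card Ω, hN, hN, E', fun x a => (E' x a)ᵀ, ψ,
      fun x a => ⟨(hE x a).1.submatrix f, hE'2 x a⟩, hE'1,
      fun x a => ⟨((hE x a).1.submatrix f).transpose, ?_⟩, ?_, ?_, ?_⟩
    · rw [← Matrix.transpose_mul, hE'2]
    · intro y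
      rw [← Matrix.transpose_sum, hE'1, Matrix.transpose_one]
    · have : star ψ ⬝ᵥ ψ = ∑ a : Fin (Fintype.card Ω), s * s := by
        simp only [dotProduct, Fintype.sum_prod_type]
        refine Finset.sum_congr rfl fun a _ => ?_
        rw [Finset.sum_eq_single a]
        · have h1 : ψ (a, a) = s := by simp [ψ]
          rw [Pi.star_apply, h1, hs']
        · intro b _ hb
          simp [ψ, Matrix.one_apply_ne (Ne.symm hb)]
        · simp
      rw [this, hs]
      simp [hNc]
    · intro x y a b
      rw [kron_form _ _ ψ (s • 1) (fun _ _ => rfl)]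
      simp only [Matrix.conjTranspose_smul, Matrix.conjTranspose_one, Matrix.smul_mul,
        Matrix.mul_smul, Matrix.one_mul, Matrix.mul_one, Matrix.transpose_transpose, hs',
        Matrix.trace_smul, smul_eq_mul]
      rw [← mul_assoc, hs]
      simp only [E']
      rw [Matrix.submatrix_mul_equiv]
      have : ((E x a * E y b).submatrix f f).trace = (E x a * E y b).trace := by
        simp only [Matrix.trace, Matrix.diag, Matrix.submatrix_apply]
        exact Equiv.sum_comp f (fun i => (E x a * E y b) i i)
      rw [this]
      push_cast
      rw [(hre x y a b).2]
      field_simp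
  · intro x y a b
    refine ⟨div_nonneg (hre x y a b).1 hNr.le, ?_⟩
    rw [div_le_one hNr]
    have h1 : ∑ a, ∑ b, (E x a * E y b).trace.re = Fintype.card Ω := by
      simp only [← Complex.re_sum, ← Matrix.trace_sum, ← Matrix.mul_sum, hE1, Matrix.mul_one]
      simp
    rw [← h1]
    calc _ ≤ ∑ b, (E x a * E y b).trace.re :=
          Finset.single_le_sum (f := fun b => (E x a * E y b).trace.re)
            (fun b _ => (hre x y a b).1) (Finset.mem_univ b)
      _ ≤ _ := Finset.single_le_sum (f := fun a => ∑ b, (E x a * E y b).trace.re)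
            (fun a _ => Finset.sum_nonneg fun b _ => (hre x y a b).1) (Finset.mem_univ a)

lemma perfectQA_of_approx {I O : Type} [Fintype I] [Fintype O] (lose : I → I → O → O → Prop)
    (h : ∀ n : ℕ, ∃ p ∈ QCorr I O, (∀ x y a b, p x y a b ∈ Set.Icc (0 : ℝ) 1) ∧
      ∀ x y a b, lose x y a b → p x y a b ≤ 1 / ((n : ℝ) + 1)) : PerfectQA lose := by
  choose p hp hp1 hpl using h
  have hc : IsCompact (Set.Icc (0 : I → I → O → O → ℝ) 1) := isCompact_Icc
  obtain ⟨q, -, φ, hφ, hq⟩ := hc.tendsto_subseq (x := p)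
    (fun n => ⟨fun x y a b => (hp1 n x y a b).1, fun x y a b => (hp1 n x y a b).2⟩)
  refine ⟨q, mem_closure_of_tendsto hq (Filter.Eventually.of_forall fun n => hp _), ?_⟩
  intro x y a b hl
  have h1 : Filter.Tendsto (fun n => p (φ n) x y a b) Filter.atTop (nhds (q x y a b)) := by
    simp only [tendsto_pi_nhds] at hq
    exact hq x y a b
  have h2 : Filter.Tendsto (fun n => p (φ n) x y a b) Filter.atTop (nhds 0) := by
    refine squeeze_zero (fun n => (hp1 _ x y a b).1) (fun n => hpl _ x y a b hl) ?_
    exact tendsto_one_div_add_atTop_nhds_zero_nat.comp hφ.tendsto_atTop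
  exact tendsto_nhds_unique h1 h2

/-! ### Part 4: the constraint system and its graph -/

/-- Variables of the constraint system.  `Sb` is a second name of `S`. -/
inductive Vr
  | X1 | Z1 | X2 | Z2 | X3 | Z3 | X1X3 | Z1Z3 | X1Z3 | Z1X3 | P | X2X3 | Z2Z3
  | C | CX3 | Q | R | S | Sb | Rp | Sm | G | R2 | V2 | Y1 | S2 | G2 | Y2
  deriving DecidableEq

/-- Identification of the two names of `S`. -/
def Vr.base : Vr → Vr
  | .Sb => .S
  | v => v

/-- Kinds of constraints on triples of commuting involutions. -/
inductive Kd
  | Lp | Lm | Tp | Tm | Fr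
  deriving DecidableEq

/-- The equation imposed by a constraint. -/
def Kd.Eqn {A : Type} [Ring A] : Kd → A → A → A → Prop
  | .Lp, x, y, z => x * y * z = 1
  | .Lm, x, y, z => x * y * z = -1
  | .Tp, x, y, z => 2 * z = y + x * y + 1 - x
  | .Tm, x, y, z => 2 * z = y - x * y + 1 + x
  | .Fr, _, _, _ => True

instance (k : Kd) (x y z : ℤ) : Decidable (k.Eqn x y z) := by
  cases k <;> (simp only [Kd.Eqn]; infer_instance)

/-- Number of contexts. -/
abbrev nC : ℕ := 26

open Vr Kd in
/-- The contexts. -/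
def ctx : Fin nC → Kd × (Fin 3 → Vr) :=
  ![(Lp, ![X1, X3, X1X3]),
    (Lp, ![Z1, Z3, Z1Z3]),
    (Lp, ![X1, Z3, X1Z3]),
    (Lp, ![Z1, X3, Z1X3]),
    (Lp, ![X1X3, Z1Z3, P]),
    (Lm, ![X1Z3, Z1X3, P]),
    (Lp, ![X2, X3, X2X3]),
    (Lp, ![Z2, Z3, Z2Z3]),
    (Fr, ![X2, Z3, R]),
    (Fr, ![Z1, Z2, X3]),
    (Fr, ![X2X3, Z2Z3, R]),
    (Lp, ![C, X3, CX3]),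
    (Lp, ![CX3, Z2Z3, Q]),
    (Tp, ![Z1, R, Rp]),
    (Tm, ![Z1, S, Sm]),
    (Lp, ![Rp, Sm, G]),
    (Tp, ![Z2, R, R2]),
    (Tm, ![Z2, X1, V2]),
    (Lp, ![R2, V2, Y1]),
    (Tp, ![Z2, Sb, S2]),
    (Tm, ![Z2, G, G2]),
    (Lp, ![S2, G2, Y2]),
    (Fr, ![C, Y1, Z3]),
    (Fr, ![C, Y2, Z3]),
    (Fr, ![X1, R, X2]),
    (Fr, ![X1, S, X2])]

/-- The kind of a context. -/
abbrev kd (c : Fin nC) : Kd := (ctx c).1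
/-- The variables of a context. -/
abbrev vr (c : Fin nC) (i : Fin 3) : Vr := (ctx c).2 i

lemma vr_inj (c : Fin nC) (i j : Fin 3) (h : (vr c i).base = (vr c j).base) : i = j := by
  revert c i j; decide

lemma vr_surj (v : Vr) : ∃ c i, (vr c i).base = v.base := by
  revert v
  intro v; cases v <;> decide

/-- Sign of a bit. -/
def sg (b : Bool) : ℤ := if b then -1 else 1

/-- Satisfying assignments of a context. -/
abbrev Sat (c : Fin nC) : Type :=
  {f : Fin 3 → Bool // (kd c).Eqn (sg (f 0)) (sg (f 1)) (sg (f 2))}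

/-- Vertices of the graph. -/
abbrev Vx : Type := Σ c : Fin nC, Sat c

/-- Two vertices conflict. -/
def conflict (u v : Vx) : Prop :=
  ∃ i j, (vr u.1 i).base = (vr v.1 j).base ∧ u.2.1 i ≠ v.2.1 j

/-- The graph. -/
def gr : SimpleGraph Vx := SimpleGraph.fromRel conflict

lemma gr_adj (u v : Vx) : gr.Adj u v ↔ u ≠ v ∧ conflict u v := by
  rw [gr, SimpleGraph.fromRel_adj]
  constructor
  · rintro ⟨h, h1 | ⟨i, j, h1, h2⟩⟩
    · exact ⟨h, h1⟩
    · exact ⟨h, j, i, h1.symm, h2.symm⟩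
  · rintro ⟨h, h1⟩
    exact ⟨h, Or.inl h1⟩

/-- Operators solving a constraint. -/
structure Kd.Rel {A : Type} [Ring A] (k : Kd) (x y z : A) : Prop where
  xx : x * x = 1
  yy : y * y = 1
  zz : z * z = 1
  xy : x * y = y * x
  xz : x * z = z * x
  yz : y * z = z * y
  eqn : k.Eqn x y z

/-! ### Part 5: from a perfect q-strategy to operators -/

section soundness

variable {W : Type} [AddCommGroup W] [Module ℂ W] [FiniteDimensional ℂ W]

lemma sum_idem_zero {ι : Type} [Fintype ι] (q : ι → Module.End ℂ W)
    (hq : ∀ i, q i * q i = q i) (h : ∑ i, q i = 0) (i : ι) : q i = 0 := by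
  have h1 : ∀ i, LinearMap.trace ℂ W (q i) = Module.finrank ℂ (LinearMap.range (q i)) := by
    intro i
    exact (LinearMap.IsIdempotentElem.isProj_range (q i) (hq i)).trace
  have h2 := congrArg (LinearMap.trace ℂ W) h
  rw [map_sum, map_zero] at h2
  simp only [h1] at h2
  have h3 : ∑ i, Module.finrank ℂ (LinearMap.range (q i)) = 0 := by exact_mod_cast h2
  have h4 := (Finset.sum_eq_zero_iff.mp h3) i (Finset.mem_univ i)
  rw [Submodule.finrank_eq_zero, LinearMap.range_eq_bot] at h4
  exact h4

lemma exists_P (e : Fin nC → Vx → Module.End ℂ W) (he1 : ∀ x, ∑ a, e x a = 1)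
    (he : ∀ x y a b, indepLose gr nC x y a b → e x a * e y b = 0) :
    ∃ p : (c : Fin nC) → Sat c → Module.End ℂ W, (∀ c, ∑ f, p c f = 1) ∧
      ∀ c f d g, conflict ⟨c, f⟩ ⟨d, g⟩ → p c f * p d g = 0 := by
  let P : Vx → Module.End ℂ W := fun v => ∑ i, e i v
  have hidem : ∀ i v, e i v * e i v = e i v := by
    intro i v
    conv_rhs => rw [← mul_one (e i v), ← he1 i, Finset.mul_sum]
    symm
    exact Finset.sum_eq_single v (fun w _ hw => he _ _ _ _ (Or.inl ⟨rfl, Ne.symm hw⟩)) (by simp)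
  have hadj : ∀ u v, gr.Adj u v → P u * P v = 0 := by
    intro u v h
    simp only [P, Finset.sum_mul, Finset.mul_sum]
    refine Finset.sum_eq_zero fun i _ => Finset.sum_eq_zero fun j _ => he _ _ _ _ ?_
    by_cases hij : j = i
    · exact Or.inl ⟨hij, h.ne⟩
    · exact Or.inr ⟨hij, Or.inr h⟩
  have hPP : ∀ v, P v * P v = P v := by
    intro v
    simp only [P]
    rw [Finset.sum_mul]
    refine Finset.sum_congr rfl fun i _ => ?_
    rw [Finset.mul_sum, Finset.sum_eq_single i, hidem]
    · intro j _ hj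
      exact he _ _ _ _ (Or.inr ⟨Ne.symm hj, Or.inl rfl⟩)
    · simp
  have hsame : ∀ c (f g : Sat c), f ≠ g → gr.Adj ⟨c, f⟩ ⟨c, g⟩ := by
    intro c f g hfg
    rw [gr_adj]
    refine ⟨fun h => hfg (by simpa using h), ?_⟩
    have : f.1 ≠ g.1 := fun h => hfg (Subtype.ext h)
    obtain ⟨i, hi⟩ := Function.ne_iff.mp this
    exact ⟨i, i, rfl, hi⟩
  have hQ : ∀ c, (∑ f, P ⟨c, f⟩) * (∑ f, P ⟨c, f⟩) = ∑ f, P ⟨c, f⟩ := by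
    intro c
    rw [Finset.sum_mul]
    refine Finset.sum_congr rfl fun f _ => ?_
    rw [Finset.mul_sum, Finset.sum_eq_single f, hPP]
    · intro g _ hg
      exact hadj _ _ (hsame c f g (Ne.symm hg))
    · simp
  have htot : ∑ c, (1 - ∑ f, P ⟨c, f⟩) = 0 := by
    rw [Finset.sum_sub_distrib]
    have : ∑ c, ∑ f, P ⟨c, f⟩ = ∑ v, P v := (Fintype.sum_sigma (fun v => P v)).symm
    rw [this]
    simp only [P]
    rw [Finset.sum_comm, Finset.sum_congr rfl fun i _ => he1 i]
    simp
  refine ⟨fun c f => P ⟨c, f⟩, fun c => ?_, fun c f d g h => ?_⟩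
  · have := sum_idem_zero (fun c => 1 - ∑ f, P ⟨c, f⟩) (fun c => by
      have := hQ c
      simp only [sub_mul, mul_sub, one_mul, mul_one, this]; simp) htot c
    exact (sub_eq_zero.mp this).symm
  · apply hadj
    rw [gr_adj]
    refine ⟨?_, h⟩
    intro heq
    rw [Sigma.mk.injEq] at heq
    obtain ⟨rfl, h2⟩ := heq
    obtain rfl := eq_of_heq h2
    obtain ⟨i, j, h1, h2⟩ := h
    obtain rfl := vr_inj _ _ _ h1
    exact h2 rfl

lemma exists_X (p : (c : Fin nC) → Sat c → Module.End ℂ W) (hp1 : ∀ c, ∑ f, p c f = 1)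
    (hp : ∀ c f d g, conflict ⟨c, f⟩ ⟨d, g⟩ → p c f * p d g = 0) :
    ∃ X : Vr → Module.End ℂ W, X .Sb = X .S ∧
      ∀ c, (kd c).Rel (X (vr c 0)) (X (vr c 1)) (X (vr c 2)) := by
  let Φ : (c : Fin nC) → (Sat c → ℤ) → Module.End ℂ W := fun c g => ∑ f, g f • p c f
  have hsame : ∀ c (f g : Sat c), f ≠ g → p c f * p c g = 0 := by
    intro c f g hfg
    apply hp
    have : f.1 ≠ g.1 := fun h => hfg (Subtype.ext h)
    obtain ⟨i, hi⟩ := Function.ne_iff.mp this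
    exact ⟨i, i, rfl, hi⟩
  have hidem : ∀ c f, p c f * p c f = p c f := by
    intro c f
    conv_rhs => rw [← mul_one (p c f), ← hp1 c, Finset.mul_sum]
    symm
    exact Finset.sum_eq_single f (fun g _ hg => hsame _ _ _ (Ne.symm hg)) (by simp)
  have Φmul : ∀ c g h, Φ c g * Φ c h = Φ c (fun f => g f * h f) := by
    intro c g h
    simp only [Φ]
    rw [Finset.sum_mul]
    refine Finset.sum_congr rfl fun f _ => ?_
    rw [Finset.mul_sum, Finset.sum_eq_single f]
    · rw [smul_mul_smul_comm, hidem]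
    · intro f' _ hf
      rw [smul_mul_smul_comm, hsame _ _ _ (Ne.symm hf), smul_zero]
    · simp
  have Φone : ∀ c, Φ c (fun _ => 1) = 1 := by intro c; simp [Φ, hp1]
  have Φadd : ∀ c g h, Φ c g + Φ c h = Φ c (fun f => g f + h f) := by
    intro c g h; simp only [Φ, add_smul, Finset.sum_add_distrib]
  have Φsub : ∀ c g h, Φ c g - Φ c h = Φ c (fun f => g f - h f) := by
    intro c g h; simp only [Φ, sub_smul, Finset.sum_sub_distrib]
  have Φneg : ∀ c g, - Φ c g = Φ c (fun f => - g f) := by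
    intro c g; simp [Φ]
  have Φtwo : ∀ c g, 2 * Φ c g = Φ c (fun f => 2 * g f) := by
    intro c g; rw [two_mul, Φadd]; congr 1; funext f; ring
  let x : Fin nC → Fin 3 → Module.End ℂ W := fun c i => Φ c (fun f => sg (f.1 i))
  have hwd : ∀ c i d j, (vr c i).base = (vr d j).base → x c i = x d j := by
    intro c i d j h
    simp only [x, Φ]
    have h1 : ∑ f, sg (f.1 i) • p c f = ∑ f, ∑ g, sg (f.1 i) • (p c f * p d g) := by
      refine Finset.sum_congr rfl fun f _ => ?_
      rw [← Finset.smul_sum, ← Finset.mul_sum, hp1, mul_one]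
    have h2 : ∑ g, sg (g.1 j) • p d g = ∑ f, ∑ g, sg (g.1 j) • (p c f * p d g) := by
      rw [Finset.sum_comm]
      refine Finset.sum_congr rfl fun f _ => ?_
      rw [← Finset.smul_sum, ← Finset.sum_mul, hp1, one_mul]
    rw [h1, h2]
    refine Finset.sum_congr rfl fun f _ => Finset.sum_congr rfl fun g _ => ?_
    by_cases hfg : f.1 i = g.1 j
    · rw [hfg]
    · rw [hp c f d g ⟨i, j, h, hfg⟩, smul_zero, smul_zero]
  choose cc ii hci using vr_surj
  let X : Vr → Module.End ℂ W := fun v => x (cc v) (ii v)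
  have hX : ∀ c i, X (vr c i) = x c i := fun c i => hwd _ _ _ _ (hci _)
  have hsq : ∀ b, sg b * sg b = 1 := by decide
  refine ⟨X, hwd _ _ _ _ ?_, fun c => ?_⟩
  · rw [hci, hci]; rfl
  · rw [hX, hX, hX]
    have hE : (kd c).Eqn (x c 0) (x c 1) (x c 2) := by
      have aux : ∀ k : Kd, (∀ f : Sat c, k.Eqn (sg (f.1 0)) (sg (f.1 1)) (sg (f.1 2))) →
          k.Eqn (x c 0) (x c 1) (x c 2) := by
        intro k hs
        cases k <;> simp only [Kd.Eqn, x, Φmul, ← Φone c, Φadd, Φsub, Φneg, Φtwo] at hs ⊢ <;>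
          (try congr 1) <;> (try funext f) <;> (try exact hs f)
      exact aux _ fun f => f.2
    refine ⟨?_, ?_, ?_, ?_, ?_, ?_, hE⟩ <;> simp only [x, Φmul, ← Φone c] <;> congr 1 <;>
      funext f <;> first | exact hsq _ | exact mul_comm _ _

end soundness

/-! ### Part 6: no finite-dimensional operator solution -/

lemma Lp_eq {A : Type} [Ring A] {x y z : A} (h : Kd.Lp.Rel x y z) : x * y = z := by
  have h1 : x * y * z = 1 := h.eqn
  calc x * y = x * y * (z * z) := by rw [h.zz, mul_one]
    _ = x * y * z * z := by noncomm_ring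
    _ = z := by rw [h1, one_mul]

lemma Lm_eq {A : Type} [Ring A] {x y z : A} (h : Kd.Lm.Rel x y z) : x * y = -z := by
  have h1 : x * y * z = -1 := h.eqn
  calc x * y = x * y * (z * z) := by rw [h.zz, mul_one]
    _ = x * y * z * z := by noncomm_ring
    _ = -z := by rw [h1]; noncomm_ring

lemma anti_of {A : Type} [Ring A] {u v x z : A} (hx : x * x = 1) (hz : z * z = 1)
    (uz : u * z = z * u) (vx : v * x = x * v)
    (hc : (u * x) * (v * z) = (v * z) * (u * x)) (ha : x * z = -(z * x)) :
    u * v = -(v * u) := by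
  have h1 : (u * v) * (x * z) = -((v * u) * (x * z)) := by
    calc (u * v) * (x * z) = u * (v * x) * z := by noncomm_ring
      _ = (u * x) * (v * z) := by rw [vx]; noncomm_ring
      _ = (v * z) * (u * x) := hc
      _ = v * (z * u) * x := by noncomm_ring
      _ = (v * u) * (z * x) := by rw [← uz]; noncomm_ring
      _ = -((v * u) * (x * z)) := by rw [ha]; noncomm_ring
  have h2 : (x * z) * (z * x) = 1 := by
    calc (x * z) * (z * x) = x * (z * z) * x := by noncomm_ring
      _ = 1 := by rw [hz, mul_one, hx]
  calc u * v = (u * v) * (x * z) * (z * x) := by rw [mul_assoc, h2, mul_one]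
    _ = -((v * u) * ((x * z) * (z * x))) := by rw [h1]; noncomm_ring
    _ = -(v * u) := by rw [h2, mul_one]

lemma anti_magic {A : Type} [Ring A] {x1 z1 x3 z3 : A} (h1 : x1 * x1 = 1) (h2 : z1 * z1 = 1)
    (zx : z1 * x3 = x3 * z1) (zz : z1 * z3 = z3 * z1)
    (h : (x1 * x3) * (z1 * z3) = -((x1 * z3) * (z1 * x3))) : x3 * z3 = -(z3 * x3) := by
  calc x3 * z3 = (z1 * ((x1 * x1) * z1)) * x3 * z3 := by rw [h1, one_mul, h2, one_mul]
    _ = z1 * x1 * (x1 * (z1 * x3) * z3) := by noncomm_ring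
    _ = z1 * x1 * ((x1 * x3) * (z1 * z3)) := by rw [zx]; noncomm_ring
    _ = -(z1 * (x1 * x1) * (z3 * z1) * x3) := by rw [h]; noncomm_ring
    _ = -((z1 * z1) * (z3 * x3)) := by rw [h1, ← zz]; noncomm_ring
    _ = _ := by rw [h2, one_mul]

section nogo

variable {W : Type} [AddCommGroup W] [Module ℂ W]

lemma app_eq {f g f' g' : Module.End ℂ W} (h : f * g = f' * g') (v : W) :
    f (g v) = f' (g' v) := LinearMap.congr_fun h v

lemma app_neg {f g f' g' : Module.End ℂ W} (h : f * g = -(f' * g')) (v : W) :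
    f (g v) = -(f' (g' v)) := LinearMap.congr_fun h v

lemma app_one {f g : Module.End ℂ W} (h : f * g = 1) (v : W) :
    f (g v) = v := LinearMap.congr_fun h v

lemma two_cancel {v w : W} (h : v + v = w + w) : v = w := by
  have h2 : (2 : ℂ) • v = (2 : ℂ) • w := by rw [two_smul, two_smul, h]
  exact (smul_right_injective W (two_ne_zero (α := ℂ))) h2

lemma Tp_pos {x y z : Module.End ℂ W} (h : Kd.Tp.Rel x y z) {v : W} (hv : x v = v) :
    z v = y v := by
  have h1 : 2 * z = y + x * y + 1 - x := h.eqn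
  have h2 := LinearMap.congr_fun h1 v
  rw [two_mul] at h2
  simp only [LinearMap.add_apply, LinearMap.sub_apply, Module.End.one_apply, hv,
    Module.End.mul_apply, app_eq h.xy] at h2
  apply two_cancel; rw [h2]; abel

lemma Tp_neg {x y z : Module.End ℂ W} (h : Kd.Tp.Rel x y z) {v : W} (hv : x v = -v) :
    z v = v := by
  have h1 : 2 * z = y + x * y + 1 - x := h.eqn
  have h2 := LinearMap.congr_fun h1 v
  rw [two_mul] at h2
  simp only [LinearMap.add_apply, LinearMap.sub_apply, Module.End.one_apply, hv,
    Module.End.mul_apply, app_eq h.xy, map_neg] at h2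
  apply two_cancel; rw [h2]; abel

lemma Tm_pos {x y z : Module.End ℂ W} (h : Kd.Tm.Rel x y z) {v : W} (hv : x v = v) :
    z v = v := by
  have h1 : 2 * z = y - x * y + 1 + x := h.eqn
  have h2 := LinearMap.congr_fun h1 v
  rw [two_mul] at h2
  simp only [LinearMap.add_apply, LinearMap.sub_apply, Module.End.one_apply, hv,
    Module.End.mul_apply, app_eq h.xy] at h2
  apply two_cancel; rw [h2]; abel

lemma Tm_neg {x y z : Module.End ℂ W} (h : Kd.Tm.Rel x y z) {v : W} (hv : x v = -v) :
    z v = y v := by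
  have h1 : 2 * z = y - x * y + 1 + x := h.eqn
  have h2 := LinearMap.congr_fun h1 v
  rw [two_mul] at h2
  simp only [LinearMap.add_apply, LinearMap.sub_apply, Module.End.one_apply, hv,
    Module.End.mul_apply, app_eq h.xy, map_neg] at h2
  apply two_cancel; rw [h2]; abel

lemma sel {x r s p q g : Module.End ℂ W} (h1 : Kd.Tp.Rel x r p) (h2 : Kd.Tm.Rel x s q)
    (h3 : Kd.Lp.Rel p q g) (v : W) :
    (x v = v → g v = r v) ∧ (x v = -v → g v = s v) := by
  have hg := Lp_eq h3
  constructor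
  · intro hv
    rw [← hg, Module.End.mul_apply, Tm_pos h2 hv, Tp_pos h1 hv]
  · intro hv
    rw [← hg, h3.xy, Module.End.mul_apply, Tp_neg h1 hv, Tm_neg h2 hv]

lemma sel_comm {x r s p q g : Module.End ℂ W} (h1 : Kd.Tp.Rel x r p) (h2 : Kd.Tm.Rel x s q)
    (h3 : Kd.Lp.Rel p q g) : x * g = g * x := by
  rw [← Lp_eq h3, ← mul_assoc, h1.xz, mul_assoc, h2.xz, mul_assoc]

lemma core [FiniteDimensional ℂ W] [Nontrivial W]
    (x1 z1 x2 z2 c r s g y1 y2 : Module.End ℂ W)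
    (x11 : ∀ v, x1 (x1 v) = v) (z11 : ∀ v, z1 (z1 v) = v) (x22 : ∀ v, x2 (x2 v) = v)
    (z22 : ∀ v, z2 (z2 v) = v) (cc : ∀ v, c (c v) = v)
    (gg : ∀ v, g (g v) = v)
    (ax1 : ∀ v, x1 (z1 v) = -z1 (x1 v)) (ax2 : ∀ v, x2 (z2 v) = -z2 (x2 v))
    (acz : ∀ v, c (z2 v) = -z2 (c v)) (z12 : ∀ v, z1 (z2 v) = z2 (z1 v))
    (z2r : ∀ v, z2 (r v) = r (z2 v)) (z2s : ∀ v, z2 (s v) = s (z2 v))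
    (z2x : ∀ v, z2 (x1 v) = x1 (z2 v)) (z2g : ∀ v, z2 (g v) = g (z2 v))
    (z1r : ∀ v, z1 (r v) = r (z1 v)) (z1s : ∀ v, z1 (s v) = s (z1 v))
    (z1g : ∀ v, z1 (g v) = g (z1 v))
    (x1r : ∀ v, x1 (r v) = r (x1 v)) (x1s : ∀ v, x1 (s v) = s (x1 v))
    (rx2 : ∀ v, r (x2 v) = x2 (r v)) (sx2 : ∀ v, s (x2 v) = x2 (s v))
    (hg : ∀ v, (z1 v = v → g v = r v) ∧ (z1 v = -v → g v = s v))
    (hy1 : ∀ v, (z2 v = v → y1 v = r v) ∧ (z2 v = -v → y1 v = x1 v))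
    (hy2 : ∀ v, (z2 v = v → y2 v = s v) ∧ (z2 v = -v → y2 v = g v))
    (cy1 : ∀ v, c (y1 v) = y1 (c v)) (cy2 : ∀ v, c (y2 v) = y2 (c v)) : False := by
  classical
  let S : Set ℂ := {l | ∃ v, v ≠ 0 ∧ z2 v = -v ∧ r (s v) = l • v}
  let T : Set ℂ := {l | ∃ v, v ≠ 0 ∧ z2 v = -v ∧ x1 (g v) = l • v}
  have inj : ∀ f : Module.End ℂ W, (∀ v, f (f v) = v) → ∀ v, v ≠ 0 → f v ≠ 0 := by
    intro f hf v hv h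
    apply hv; rw [← hf v, h, map_zero]
  have hTS : T ⊆ S := by
    rintro l ⟨v, hv, hz, hl⟩
    have hzc : z2 (c v) = c v := by
      have := acz v
      rw [hz, map_neg] at this
      exact (neg_injective this).symm
    have hzs : z2 (s (c v)) = s (c v) := by rw [z2s, hzc]
    have hzg : z2 (g v) = - g v := by rw [z2g, hz, map_neg]
    have h1 : r (s (c v)) = l • c v := by
      rw [← (hy1 _).1 hzs, ← (hy2 _).1 hzc, ← cy2, ← cy1, (hy2 _).2 hz, (hy1 _).2 hzg, hl,
        map_smul]
    refine ⟨x2 (c v), inj x2 x22 _ (inj c cc _ hv), ?_, ?_⟩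
    · have := ax2 (c v)
      rw [hzc] at this
      exact (neg_eq_iff_eq_neg.mpr this).symm
    · rw [sx2, rx2, h1, map_smul]
  have hneg : ∀ l ∈ T, -l ∈ T := by
    rintro l ⟨v, hv, hz, hl⟩
    refine ⟨z1 v, inj z1 z11 _ hv, ?_, ?_⟩
    · rw [← z12, hz, map_neg]
    · rw [← z1g, ax1, hl, map_smul, neg_smul]
  have h0 : (0 : ℂ) ∉ T := by
    rintro ⟨v, hv, -, hl⟩
    rw [zero_smul] at hl
    exact inj x1 x11 _ (inj g gg _ hv) hl
  have hST : ∀ l ∈ S, ∃ m ∈ T, m ^ 2 = l := by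
    rintro l ⟨v, hv, hz, hl⟩
    -- choose an eigenvector in the minus eigenspace of `z1`
    have : ∃ w, w ≠ 0 ∧ z2 w = -w ∧ r (s w) = l • w ∧ z1 w = -w := by
      by_cases hw : v - z1 v = 0
      · have hw' : z1 v = v := (sub_eq_zero.mp hw).symm
        refine ⟨x1 v, inj x1 x11 _ hv, ?_, ?_, ?_⟩
        · rw [z2x, hz, map_neg]
        · rw [← x1s, ← x1r, hl, map_smul]
        · have := ax1 v
          rw [hw'] at this
          rw [this, neg_neg, ← this]
      · refine ⟨v - z1 v, hw, ?_, ?_, ?_⟩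
        · rw [map_sub, ← z12, hz, map_neg]; abel
        · rw [map_sub, map_sub, ← z1s, ← z1r, hl, map_smul, smul_sub]
        · rw [map_sub, z11]; abel
    obtain ⟨w, hw, hz, hl, hz1⟩ := this
    have hgw : g w = s w := (hg w).2 hz1
    have hz1s : z1 (s w) = - s w := by rw [z1s, hz1, map_neg]
    have hz1x : z1 (x1 (s w)) = x1 (s w) := by
      have := ax1 (s w)
      rw [hz1s, map_neg] at this
      exact (neg_injective this).symm
    have ha2 : x1 (g (x1 (g w))) = l • w := by
      rw [hgw, (hg _).1 hz1x, x1r, x11, hl]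
    obtain ⟨m, hm⟩ := IsSquare.exists_sq l (by exact IsAlgClosed.exists_pow_nat_eq l two_pos |>.imp (fun z hz => by rw [← hz, sq]))
    by_cases hu : x1 (g w) + m • w = 0
    · refine ⟨-m, ⟨w, hw, hz, ?_⟩, by rw [neg_sq, hm]⟩
      rw [neg_smul]; exact eq_neg_of_add_eq_zero_left hu
    · refine ⟨m, ⟨_, hu, ?_, ?_⟩, hm.symm⟩
      · rw [map_add, map_smul, z2x, z2g, hz, map_neg, map_neg, smul_neg]; abel
      · rw [map_add, map_add, map_smul, map_smul, ha2, smul_add, smul_smul, ← sq, hm]; abel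
  have hfin : S.Finite := by
    refine Set.Finite.subset (Module.End.finite_hasEigenvalue (r * s)) ?_
    rintro l ⟨v, hv, -, hl⟩
    exact Module.End.hasEigenvalue_of_hasEigenvector (x := v)
      ⟨Module.End.mem_eigenspace_iff.mpr hl, hv⟩
  have hne : S.Nonempty := by
    let U : Submodule ℂ W := LinearMap.ker (z2 + 1)
    have hU : ∀ v, v ∈ U ↔ z2 v = -v := by
      intro v
      simp only [U, LinearMap.mem_ker, LinearMap.add_apply, Module.End.one_apply]
      exact ⟨eq_neg_of_add_eq_zero_left, fun h => by rw [h]; abel⟩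
    have hmap : ∀ v ∈ U, (r * s) v ∈ U := by
      intro v hv
      rw [hU] at hv ⊢
      rw [Module.End.mul_apply, z2r, z2s, hv, map_neg, map_neg]
    have hnt : Nontrivial U := by
      obtain ⟨v, hv⟩ := exists_ne (0 : W)
      by_cases hw : v - z2 v = 0
      · have hw' : z2 v = v := (sub_eq_zero.mp hw).symm
        refine ⟨⟨⟨x2 v, ?_⟩, 0, ?_⟩⟩
        · rw [hU]
          have := ax2 v
          rw [hw'] at this
          rw [this, neg_neg, ← this]
        · intro h
          exact inj x2 x22 _ hv (congrArg Subtype.val h)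
      · refine ⟨⟨⟨v - z2 v, ?_⟩, 0, ?_⟩⟩
        · rw [hU, map_sub, z22]; abel
        · intro h
          exact hw (congrArg Subtype.val h)
    obtain ⟨l, hl⟩ := Module.End.exists_eigenvalue ((r * s).restrict hmap)
    obtain ⟨v, hv⟩ := hl.exists_hasEigenvector
    refine ⟨l, v.1, fun h => hv.2 (Subtype.ext h), (hU _).1 v.2, ?_⟩
    have := congrArg Subtype.val (Module.End.mem_eigenspace_iff.mp hv.1)
    simpa using this
  have hTfin : T.Finite := hfin.subset hTS
  have hsub : hTfin.toFinset ⊆ hTfin.toFinset.image (fun m => m ^ 2) := by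
    intro l hl
    rw [Set.Finite.mem_toFinset] at hl
    obtain ⟨m, hm, hml⟩ := hST l (hTS hl)
    exact Finset.mem_image.mpr ⟨m, by simpa using hm, hml⟩
  have hinj := Finset.card_image_iff.mp (le_antisymm Finset.card_image_le (Finset.card_le_card hsub))
  obtain ⟨l, hl⟩ := hne
  obtain ⟨m, hm, -⟩ := hST l hl
  have h1 : m = -m := hinj (by simpa using hm) (by simpa using hneg m hm) (by simp)
  have h2 : m = 0 := self_eq_neg.mp h1
  exact h0 (h2 ▸ hm)

lemma nogo [FiniteDimensional ℂ W] [Nontrivial W] (X : Vr → Module.End ℂ W)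
    (hS : X .Sb = X .S) (h : ∀ c, (kd c).Rel (X (vr c 0)) (X (vr c 1)) (X (vr c 2))) :
    False := by
  have h0 : Kd.Lp.Rel (X .X1) (X .X3) (X .X1X3) := h 0
  have h1 : Kd.Lp.Rel (X .Z1) (X .Z3) (X .Z1Z3) := h 1
  have h2 : Kd.Lp.Rel (X .X1) (X .Z3) (X .X1Z3) := h 2
  have h3 : Kd.Lp.Rel (X .Z1) (X .X3) (X .Z1X3) := h 3
  have h4 : Kd.Lp.Rel (X .X1X3) (X .Z1Z3) (X .P) := h 4
  have h5 : Kd.Lm.Rel (X .X1Z3) (X .Z1X3) (X .P) := h 5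
  have h6 : Kd.Lp.Rel (X .X2) (X .X3) (X .X2X3) := h 6
  have h7 : Kd.Lp.Rel (X .Z2) (X .Z3) (X .Z2Z3) := h 7
  have h8 : Kd.Fr.Rel (X .X2) (X .Z3) (X .R) := h 8
  have h9 : Kd.Fr.Rel (X .Z1) (X .Z2) (X .X3) := h 9
  have h10 : Kd.Fr.Rel (X .X2X3) (X .Z2Z3) (X .R) := h 10
  have h11 : Kd.Lp.Rel (X .C) (X .X3) (X .CX3) := h 11
  have h12 : Kd.Lp.Rel (X .CX3) (X .Z2Z3) (X .Q) := h 12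
  have h13 : Kd.Tp.Rel (X .Z1) (X .R) (X .Rp) := h 13
  have h14 : Kd.Tm.Rel (X .Z1) (X .S) (X .Sm) := h 14
  have h15 : Kd.Lp.Rel (X .Rp) (X .Sm) (X .G) := h 15
  have h16 : Kd.Tp.Rel (X .Z2) (X .R) (X .R2) := h 16
  have h17 : Kd.Tm.Rel (X .Z2) (X .X1) (X .V2) := h 17
  have h18 : Kd.Lp.Rel (X .R2) (X .V2) (X .Y1) := h 18
  have h19 : Kd.Tp.Rel (X .Z2) (X .Sb) (X .S2) := h 19
  have h20 : Kd.Tm.Rel (X .Z2) (X .G) (X .G2) := h 20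
  have h21 : Kd.Lp.Rel (X .S2) (X .G2) (X .Y2) := h 21
  have h22 : Kd.Fr.Rel (X .C) (X .Y1) (X .Z3) := h 22
  have h23 : Kd.Fr.Rel (X .C) (X .Y2) (X .Z3) := h 23
  have h24 : Kd.Fr.Rel (X .X1) (X .R) (X .X2) := h 24
  have h25 : Kd.Fr.Rel (X .X1) (X .S) (X .X2) := h 25
  rw [hS] at h19
  have a3 : X .X3 * X .Z3 = -(X .Z3 * X .X3) := by
    refine anti_magic h0.xx h1.xx h3.xy h1.xy ?_
    rw [Lp_eq h0, Lp_eq h1, Lp_eq h2, Lp_eq h3, Lp_eq h4, Lm_eq h5, neg_neg]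
  have a1 : X .X1 * X .Z1 = -(X .Z1 * X .X1) := by
    refine anti_of h0.yy h1.yy h2.xy h3.xy ?_ a3
    rw [Lp_eq h0, Lp_eq h1, h4.xy]
  have a2 : X .X2 * X .Z2 = -(X .Z2 * X .X2) := by
    refine anti_of h0.yy h1.yy h8.xy h9.yz ?_ a3
    rw [Lp_eq h6, Lp_eq h7, h10.xy]
  have ac : X .C * X .Z2 = -(X .Z2 * X .C) := by
    refine anti_of h0.yy h1.yy h22.xz h9.yz ?_ a3
    rw [Lp_eq h11, Lp_eq h7, h12.xy]
  exact core (X .X1) (X .Z1) (X .X2) (X .Z2) (X .C) (X .R) (X .S) (X .G) (X .Y1) (X .Y2)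
    (app_one h0.xx) (app_one h1.xx) (app_one h6.xx) (app_one h7.xx) (app_one h11.xx)
    (app_one h15.zz) (app_neg a1) (app_neg a2) (app_neg ac) (app_eq h9.xy)
    (app_eq h16.xy) (app_eq h19.xy) (app_eq h17.xy) (app_eq h20.xy)
    (app_eq h13.xy) (app_eq h14.xy) (app_eq (sel_comm h13 h14 h15)) (app_eq h24.xy)
    (app_eq h25.xy) (app_eq h24.yz) (app_eq h25.yz) (sel h13 h14 h15)
    (sel h16 h17 h18) (sel h19 h20 h21) (app_eq h22.xy) (app_eq h23.xy)

end nogo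

lemma not_perfectQ : ¬ PerfectQ (indepLose gr nC) := by
  intro h
  obtain ⟨W, _, _, _, _, e, he1, he⟩ := algRep _ (fun x a b hab => Or.inl ⟨rfl, hab⟩) h
  obtain ⟨p, hp1, hp⟩ := exists_P e he1 he
  obtain ⟨X, hS, hX⟩ := exists_X p hp1 hp
  exact nogo X hS hX

/-! ### Part 7: signed permutation matrices and approximate strategies -/

section rows

variable {Ω : Type}

/-- Composition of signed maps. -/
def rmul (f g : Ω → Bool × Ω) : Ω → Bool × Ω :=
  fun i => (xor (f i).1 (g (f i).2).1, (g (f i).2).2)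

/-- The signed identity. -/
def rone (b : Bool) : Ω → Bool × Ω := fun i => (b, i)

/-- The equation of a constraint for signed maps. -/
def Kd.REqn : Kd → (Ω → Bool × Ω) → (Ω → Bool × Ω) → (Ω → Bool × Ω) → Prop
  | .Lp, x, y, z => rmul (rmul x y) z = rone false
  | .Lm, x, y, z => rmul (rmul x y) z = rone true
  | .Tp, x, y, z => ∀ i, (x i).2 = i ∧ z i = if (x i).1 then (false, i) else y i
  | .Tm, x, y, z => ∀ i, (x i).2 = i ∧ z i = if (x i).1 then y i else (false, i)
  | .Fr, _, _, _ => True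

/-- Signed maps solving a constraint. -/
structure Kd.RRel (k : Kd) (x y z : Ω → Bool × Ω) : Prop where
  xx : rmul x x = rone false
  yy : rmul y y = rone false
  zz : rmul z z = rone false
  xy : rmul x y = rmul y x
  xz : rmul x z = rmul z x
  yz : rmul y z = rmul z y
  eqn : k.REqn x y z

variable [Fintype Ω] [DecidableEq Ω]

/-- The signed matrix of a signed map. -/
def mat (f : Ω → Bool × Ω) : Matrix Ω Ω ℂ :=
  Matrix.of fun i j => if (f i).2 = j then (sg (f i).1 : ℂ) else 0

lemma mat_apply (f : Ω → Bool × Ω) (i j : Ω) :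
    mat f i j = if (f i).2 = j then (sg (f i).1 : ℂ) else 0 := rfl

lemma sg_xor (a b : Bool) : sg (xor a b) = sg a * sg b := by revert a b; decide

lemma mat_mul_apply (f : Ω → Bool × Ω) (M : Matrix Ω Ω ℂ) (i j : Ω) :
    (mat f * M) i j = sg (f i).1 * M (f i).2 j := by
  rw [Matrix.mul_apply, Finset.sum_eq_single (f i).2]
  · simp [mat_apply]
  · intro k _ hk
    simp [mat_apply, Ne.symm hk]
  · simp

lemma mat_mul (f g : Ω → Bool × Ω) : mat f * mat g = mat (rmul f g) := by
  ext i j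
  rw [mat_mul_apply, mat_apply, mat_apply]
  simp only [rmul, sg_xor]
  split_ifs <;> simp

lemma mat_one : mat (rone false : Ω → Bool × Ω) = 1 := by
  ext i j
  simp [mat_apply, rone, Matrix.one_apply, sg]

lemma mat_neg_one : mat (rone true : Ω → Bool × Ω) = -1 := by
  ext i j
  simp only [mat_apply, rone, Matrix.neg_apply, Matrix.one_apply, sg]
  split_ifs <;> simp_all

lemma row_symm (f : Ω → Bool × Ω) (h : rmul f f = rone false) (i : Ω) :
    (f (f i).2) = ((f i).1, i) := by
  have := congrFun h i
  simp only [rmul, rone, Prod.mk.injEq] at this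
  obtain ⟨h1, h2⟩ := this
  refine Prod.ext ?_ h2
  simp only
  revert h1
  cases (f i).1 <;> cases (f (f i).2).1 <;> simp

lemma mat_herm (f : Ω → Bool × Ω) (h : rmul f f = rone false) : (mat f).IsHermitian := by
  ext i j
  rw [Matrix.conjTranspose_apply, mat_apply, mat_apply]
  by_cases hij : (f i).2 = j
  · subst hij
    rw [row_symm f h]
    simp
  · rw [if_neg hij, if_neg, star_zero]
    intro hji
    apply hij
    subst hji
    rw [row_symm f h]

lemma Kd.RRel.rel {k : Kd} {x y z : Ω → Bool × Ω} (h : k.RRel x y z) :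
    k.Rel (mat x) (mat y) (mat z) := by
  refine ⟨?_, ?_, ?_, ?_, ?_, ?_, ?_⟩
  · rw [mat_mul, h.xx, mat_one]
  · rw [mat_mul, h.yy, mat_one]
  · rw [mat_mul, h.zz, mat_one]
  · rw [mat_mul, mat_mul, h.xy]
  · rw [mat_mul, mat_mul, h.xz]
  · rw [mat_mul, mat_mul, h.yz]
  · have he := h.eqn
    cases k
    · simp only [Kd.Eqn, Kd.REqn] at *
      rw [mat_mul, mat_mul, he, mat_one]
    · simp only [Kd.Eqn, Kd.REqn] at *
      rw [mat_mul, mat_mul, he, mat_neg_one]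
    · simp only [Kd.Eqn, Kd.REqn] at *
      ext i j
      obtain ⟨h1, h2⟩ := he i
      simp only [two_mul, Matrix.sub_apply, Matrix.add_apply, mat_mul_apply, Matrix.one_apply]
      simp only [mat_apply, h1, h2]
      cases (x i).1 <;> simp [sg] <;> split_ifs <;> norm_num
    · simp only [Kd.Eqn, Kd.REqn] at *
      ext i j
      obtain ⟨h1, h2⟩ := he i
      simp only [two_mul, Matrix.sub_apply, Matrix.add_apply, mat_mul_apply, Matrix.one_apply]
      simp only [mat_apply, h1, h2]
      cases (x i).1 <;> simp [sg] <;> split_ifs <;> norm_num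
    · trivial

/-- Spectral projection of an involution. -/
def prj (X : Matrix Ω Ω ℂ) (b : Bool) : Matrix Ω Ω ℂ := (1 / 2 : ℂ) • (1 + (sg b : ℂ) • X)

lemma sgc (b : Bool) : (sg b : ℂ) * sg b = 1 := by cases b <;> simp [sg]

lemma mul_prj {X : Matrix Ω Ω ℂ} (h : X * X = 1) (b : Bool) :
    X * prj X b = (sg b : ℂ) • prj X b := by
  simp only [prj, Matrix.mul_smul, mul_add, mul_one, h, smul_add, smul_smul]
  rw [show (sg b : ℂ) * (1 / 2 * (sg b : ℂ)) = 1 / 2 by rw [mul_left_comm, sgc, mul_one],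
    mul_comm (sg b : ℂ) (1 / 2)]
  abel

lemma prj_idem {X : Matrix Ω Ω ℂ} (h : X * X = 1) (b : Bool) : prj X b * prj X b = prj X b := by
  conv_lhs => enter [1]; rw [prj]
  rw [Matrix.smul_mul, add_mul, one_mul, Matrix.smul_mul, mul_prj h, smul_smul, sgc, one_smul,
    ← two_smul ℂ, smul_smul]
  norm_num

lemma prj_herm {X : Matrix Ω Ω ℂ} (h : X.IsHermitian) (b : Bool) : (prj X b).IsHermitian := by
  unfold Matrix.IsHermitian
  rw [prj, Matrix.conjTranspose_smul, Matrix.conjTranspose_add, Matrix.conjTranspose_smul,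
    h.eq, Matrix.conjTranspose_one]
  simp

lemma prj_sum (X : Matrix Ω Ω ℂ) : ∑ b, prj X b = 1 := by
  rw [Fintype.sum_bool]
  simp only [prj, sg, ← smul_add]
  simp only [if_true, Bool.false_eq_true, if_false]
  have : (1 : Matrix Ω Ω ℂ) + ((-1 : ℤ) : ℂ) • X + (1 + ((1 : ℤ) : ℂ) • X) = (2 : ℂ) • 1 := by
    push_cast
    rw [two_smul, neg_smul, one_smul]; abel
  rw [this, smul_smul]; norm_num

lemma prj_comm {X Y : Matrix Ω Ω ℂ} (h : X * Y = Y * X) (a b : Bool) :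
    prj X a * prj Y b = prj Y b * prj X a := by
  have : Commute X Y := h
  have h1 : Commute (1 + (sg a : ℂ) • X) (1 + (sg b : ℂ) • Y) :=
    ((Commute.one_left _).add_left (((Commute.one_right _).add_right
      ((this.smul_left _).smul_right _))))
  exact (h1.smul_left _).smul_right _

lemma trace_prj_le (f g : Ω → Bool × Ω) (hf : rmul f f = rone false)
    (hg : rmul g g = rone false) (b : Bool) :
    (prj (mat f) b * prj (mat g) (!b)).trace.re ≤
      (Finset.univ.filter fun i => f i ≠ g i).card := by
  have h1 : prj (mat f) b * prj (mat g) (!b) = (1 / 4 : ℂ) •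
      (1 + (sg b : ℂ) • mat f - (sg b : ℂ) • mat g - mat f * mat g) := by
    have : (sg (!b) : ℂ) = - sg b := by cases b <;> simp [sg]
    simp only [prj, this, Matrix.smul_mul, Matrix.mul_smul, add_mul, mul_add, one_mul, mul_one]
    cases b <;> simp only [sg, if_true, Bool.false_eq_true, if_false] <;> push_cast <;> module
  rw [h1, Matrix.trace_smul, smul_eq_mul, Matrix.trace, Finset.mul_sum, Complex.re_sum,
    Finset.card_filter]
  push_cast
  refine Finset.sum_le_sum fun i _ => ?_
  simp only [Matrix.diag_apply, Matrix.sub_apply, Matrix.add_apply, Matrix.smul_apply,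
    mat_mul_apply, smul_eq_mul, Matrix.one_apply_eq]
  by_cases hi : f i = g i
  · rw [if_neg (by simpa using hi)]
    have h2 : g (f i).2 = ((g i).1, i) := by rw [hi, row_symm g hg]
    have h3 : mat g (f i).2 i = sg (g i).1 := by simp [mat_apply, h2]
    have h4 : mat f i i = mat g i i := by simp [mat_apply, hi]
    rw [h3, h4, hi, sgc]
    simp
  · rw [if_pos hi]
    have hb : ∀ (b b' b'' : Bool) (p : Prop) [Decidable p],
        -1 ≤ ((sg b : ℂ) * if p then (sg b' : ℂ) else 0).re ∧
          ((sg b : ℂ) * if p then (sg b' : ℂ) else 0).re ≤ 1 := by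
      intro b b' b'' p _
      cases b <;> cases b' <;> by_cases hp : p <;> simp [sg, hp]
    have e1 := hb b (f i).1 b ((f i).2 = i)
    have e2 := hb b (g i).1 b ((g i).2 = i)
    have e3 := hb (f i).1 (g (f i).2).1 b ((g (f i).2).2 = i)
    simp only [mat_apply]
    have h4 : ∀ z : ℂ, (1 / 4 * z).re = 1 / 4 * z.re := by
      intro z
      simp
    rw [h4]
    simp only [Complex.sub_re, Complex.add_re, Complex.one_re]
    linarith [e1.1, e1.2, e2.1, e2.2, e3.1, e3.2]

lemma trace_mono {A B A' B' : Matrix Ω Ω ℂ} (hA : A.IsHermitian ∧ A * A = A)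
    (hB : B.IsHermitian ∧ B * B = B) (hA' : A'.IsHermitian ∧ A' * A' = A')
    (hB' : B'.IsHermitian ∧ B' * B' = B') (h1 : A * A' = A) (h2 : B * B' = B) :
    (A * B).trace.re ≤ (A' * B').trace.re := by
  have key : ∀ C C' : Matrix Ω Ω ℂ, C.IsHermitian ∧ C * C = C → C'.IsHermitian ∧ C' * C' = C' →
      C * C' = C → (C' - C).IsHermitian ∧ (C' - C) * (C' - C) = C' - C := by
    intro C C' hC hC' h
    have h' : C' * C = C := by
      have := congrArg Matrix.conjTranspose h
      rwa [Matrix.conjTranspose_mul, hC.1.eq, hC'.1.eq] at this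
    refine ⟨hC'.1.sub hC.1, ?_⟩
    rw [sub_mul, mul_sub, mul_sub, hC.2, hC'.2, h, h']; abel
  have k1 := key A A' hA hA' h1
  have k2 := key B B' hB hB' h2
  have t1 := (trace_proj_nonneg _ _ k1.1 k1.2 hB.1 hB.2).1
  have t2 := (trace_proj_nonneg _ _ hA'.1 hA'.2 k2.1 k2.2).1
  rw [sub_mul, Matrix.trace_sub, Complex.sub_re] at t1
  rw [mul_sub, Matrix.trace_sub, Complex.sub_re] at t2
  linarith

/-- Joint spectral projection of three involutions. -/
def jp (Y : Fin 3 → Matrix Ω Ω ℂ) (f : Fin 3 → Bool) : Matrix Ω Ω ℂ :=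
  prj (Y 0) (f 0) * prj (Y 1) (f 1) * prj (Y 2) (f 2)

lemma jp_mul {Y : Fin 3 → Matrix Ω Ω ℂ} (h2 : ∀ i, Y i * Y i = 1)
    (hc : ∀ i j, Y i * Y j = Y j * Y i) (f : Fin 3 → Bool) (i : Fin 3) :
    jp Y f * prj (Y i) (f i) = jp Y f := by
  have c := fun i j => prj_comm (hc i j) (f i) (f j)
  have d := fun i => prj_idem (h2 i) (f i)
  unfold jp
  fin_cases i
  · simp only [Fin.zero_eta]
    rw [mul_assoc, c 2 0, ← mul_assoc, mul_assoc (prj (Y 0) (f 0)), c 1 0, ← mul_assoc, d]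
  · simp only [Fin.mk_one]
    rw [mul_assoc, c 2 1, ← mul_assoc, mul_assoc (prj (Y 0) (f 0)), d]
  · simp only [Fin.reduceFinMk]
    rw [mul_assoc, d]

lemma jp_proj {Y : Fin 3 → Matrix Ω Ω ℂ} (h1 : ∀ i, (Y i).IsHermitian) (h2 : ∀ i, Y i * Y i = 1)
    (hc : ∀ i j, Y i * Y j = Y j * Y i) (f : Fin 3 → Bool) :
    (jp Y f).IsHermitian ∧ jp Y f * jp Y f = jp Y f := by
  constructor
  · unfold Matrix.IsHermitian jp
    rw [Matrix.conjTranspose_mul, Matrix.conjTranspose_mul, (prj_herm (h1 0) _).eq,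
      (prj_herm (h1 1) _).eq, (prj_herm (h1 2) _).eq, prj_comm (hc 1 0), ← mul_assoc,
      prj_comm (hc 2 0), mul_assoc, prj_comm (hc 2 1), mul_assoc]
  · conv_lhs => enter [2]; rw [jp]
    rw [← mul_assoc, ← mul_assoc, jp_mul h2 hc, jp_mul h2 hc, jp_mul h2 hc]

lemma jp_left {Y : Fin 3 → Matrix Ω Ω ℂ} (h2 : ∀ i, Y i * Y i = 1)
    (hc : ∀ i j, Y i * Y j = Y j * Y i) (f : Fin 3 → Bool) (i : Fin 3) :
    Y i * jp Y f = (sg (f i) : ℂ) • jp Y f := by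
  have h3 : jp Y f * Y i = Y i * jp Y f := by
    have hc' : ∀ j, Commute (prj (Y j) (f j)) (Y i) := fun j =>
      (((Commute.one_left _).add_left ((show Commute (Y j) (Y i) from hc j i).smul_left _))).smul_left _
    exact ((hc' 0).mul_left (hc' 1)).mul_left (hc' 2)
  rw [← h3, ← jp_mul h2 hc f i, mul_assoc]
  have : prj (Y i) (f i) * Y i = (sg (f i) : ℂ) • prj (Y i) (f i) := by
    rw [← mul_prj (h2 i)]
    exact (((Commute.one_left _).add_left ((Commute.refl (Y i)).smul_left _))).smul_left _
  rw [this, Matrix.mul_smul]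

lemma jp_sum (Y : Fin 3 → Matrix Ω Ω ℂ) : ∑ f, jp Y f = 1 := by
  let e : (Fin 3 → Bool) ≃ Bool × Bool × Bool :=
    ⟨fun f => (f 0, f 1, f 2), fun p => ![p.1, p.2.1, p.2.2], by decide, by decide⟩
  have : ∑ f, jp Y f = ∑ p : Bool × Bool × Bool,
      prj (Y 0) p.1 * prj (Y 1) p.2.1 * prj (Y 2) p.2.2 :=
    Fintype.sum_equiv e _ _ (fun f => rfl)
  rw [this]
  simp only [Fintype.sum_prod_type, ← Finset.mul_sum, prj_sum, mul_one]

lemma jp_unsat {Y : Fin 3 → Matrix Ω Ω ℂ} {k : Kd} (h2 : ∀ i, Y i * Y i = 1)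
    (hc : ∀ i j, Y i * Y j = Y j * Y i) (hk : k.Eqn (Y 0) (Y 1) (Y 2)) (f : Fin 3 → Bool)
    (hf : ¬ k.Eqn (sg (f 0)) (sg (f 1)) (sg (f 2))) : jp Y f = 0 := by
  have l := jp_left h2 hc f
  have fin : ∀ n m : ℤ, n ≠ m → (n : ℂ) • jp Y f = (m : ℂ) • jp Y f → jp Y f = 0 := by
    intro n m hnm h
    rw [← sub_eq_zero, ← sub_smul] at h
    refine (smul_eq_zero.mp h).resolve_left ?_
    intro h0
    exact hnm (by exact_mod_cast sub_eq_zero.mp h0)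
  cases k <;> simp only [Kd.Eqn] at hk hf
  · refine fin _ _ hf ?_
    have := congrArg (fun M => M * jp Y f) hk
    simp only [mul_assoc, l, Matrix.mul_smul, one_mul, smul_smul] at this
    push_cast
    rw [one_smul]
    rw [← this]
    congr 1
    ring
  · refine fin _ _ hf ?_
    have := congrArg (fun M => M * jp Y f) hk
    simp only [mul_assoc, l, Matrix.mul_smul, one_mul, smul_smul, neg_mul] at this
    push_cast
    rw [neg_smul, one_smul]
    rw [← this]
    congr 1
    ring
  · refine fin _ _ hf ?_
    have := congrArg (fun M => M * jp Y f) hk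
    simp only [mul_assoc, l, Matrix.mul_smul, one_mul, smul_smul, two_mul, add_mul, sub_mul] at this
    push_cast
    rw [two_mul, add_smul, this, sub_smul, add_smul, add_smul, one_smul,
      mul_comm (sg (f 1) : ℂ)]
  · refine fin _ _ hf ?_
    have := congrArg (fun M => M * jp Y f) hk
    simp only [mul_assoc, l, Matrix.mul_smul, one_mul, smul_smul, two_mul, add_mul, sub_mul] at this
    push_cast
    rw [two_mul, add_smul, this, add_smul, add_smul, sub_smul, one_smul,
      mul_comm (sg (f 1) : ℂ)]
  · exact absurd trivial hf

lemma RRel_facts (k : Kd) (w : Fin 3 → Ω → Bool × Ω) (h : k.RRel (w 0) (w 1) (w 2)) :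
    (∀ i, rmul (w i) (w i) = rone false) ∧ (∀ i, (mat (w i)).IsHermitian) ∧
    (∀ i, mat (w i) * mat (w i) = 1) ∧ (∀ i j, mat (w i) * mat (w j) = mat (w j) * mat (w i)) ∧
    ∀ f : Fin 3 → Bool, ¬ k.Eqn (sg (f 0)) (sg (f 1)) (sg (f 2)) →
      jp (fun i => mat (w i)) f = 0 := by
  have hrel := h.rel
  have hrr : ∀ i, rmul (w i) (w i) = rone false := by
    intro i
    fin_cases i
    exacts [h.xx, h.yy, h.zz]
  have h2 : ∀ i, mat (w i) * mat (w i) = 1 := fun i => by rw [mat_mul, hrr, mat_one]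
  have hc : ∀ i j, mat (w i) * mat (w j) = mat (w j) * mat (w i) := by
    intro i j
    fin_cases i <;> fin_cases j
    exacts [rfl, hrel.xy, hrel.xz, hrel.xy.symm, rfl, hrel.yz, hrel.xz.symm,
      hrel.yz.symm, rfl]
  exact ⟨hrr, fun i => mat_herm _ (hrr i), h2, hc, fun f hf =>
    jp_unsat (Y := fun i => mat (w i)) h2 hc hrel.eqn f hf⟩

lemma completeness [Nonempty Ω] (r : Vr → Ω → Bool × Ω) (D : ℕ)
    (hr : ∀ c, (kd c).RRel (r (vr c 0)) (r (vr c 1)) (r (vr c 2)))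
    (hD : ∀ v w : Vr, v.base = w.base → (Finset.univ.filter fun i => r v i ≠ r w i).card ≤ D) :
    ∃ p ∈ QCorr (Fin nC) Vx, (∀ x y a b, p x y a b ∈ Set.Icc (0 : ℝ) 1) ∧
      ∀ x y a b, indepLose gr nC x y a b → p x y a b ≤ (D : ℝ) / Fintype.card Ω := by
  let Y : Fin nC → Fin 3 → Matrix Ω Ω ℂ := fun c i => mat (r (vr c i))
  have hw := fun c => RRel_facts (kd c) (fun i => r (vr c i)) (hr c)
  have hrr : ∀ c i, rmul (r (vr c i)) (r (vr c i)) = rone false := fun c => (hw c).1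
  have h1 : ∀ c i, (Y c i).IsHermitian := fun c => (hw c).2.1
  have h2 : ∀ c i, Y c i * Y c i = 1 := fun c => (hw c).2.2.1
  have hc : ∀ c i j, Y c i * Y c j = Y c j * Y c i := fun c => (hw c).2.2.2.1
  have hu : ∀ c (f : Fin 3 → Bool), ¬ (kd c).Eqn (sg (f 0)) (sg (f 1)) (sg (f 2)) →
    jp (Y c) f = 0 := fun c => (hw c).2.2.2.2
  let E : Fin nC → Vx → Matrix Ω Ω ℂ := fun i v => if v.1 = i then jp (Y v.1) v.2.1 else 0
  have hjp := fun c f => jp_proj (h1 c) (h2 c) (hc c) f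
  have hE : ∀ i v, (E i v).IsHermitian ∧ E i v * E i v = E i v := by
    intro i v
    simp only [E]
    split_ifs
    · exact hjp _ _
    · exact ⟨Matrix.isHermitian_zero, mul_zero _⟩
  have hE1 : ∀ i, ∑ v, E i v = 1 := by
    intro i
    rw [Fintype.sum_sigma, Finset.sum_eq_single i]
    · simp only [E, if_true]
      have hs1 : ∑ f : Sat i, jp (Y i) f.1 = ∑ f ∈ Finset.univ.filter
          (fun f : Fin 3 → Bool => (kd i).Eqn (sg (f 0)) (sg (f 1)) (sg (f 2))), jp (Y i) f :=
        (Finset.sum_subtype _ (by simp) (jp (Y i))).symm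
      rw [hs1, ← jp_sum (Y i)]
      apply Finset.sum_filter_of_ne
      intro f _ hf
      by_contra hf'
      exact hf (hu i f hf')
    · intro c _ hci
      simp [E, hci]
    · simp
  obtain ⟨hp, hI⟩ := traceCorr E hE hE1
  refine ⟨_, hp, hI, ?_⟩
  intro i j u v hl
  have hcard : (0 : ℝ) < Fintype.card Ω := by exact_mod_cast Fintype.card_pos
  rw [div_le_div_iff_of_pos_right hcard]
  by_cases hu : u.1 = i
  swap
  · simp [E, hu]
  by_cases hv : v.1 = j
  swap
  · simp [E, hv]
  have hconf : conflict u v := by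
    rcases hl with ⟨hij, huv⟩ | ⟨hij, huv | huv⟩
    · obtain ⟨c, f⟩ := u
      obtain ⟨d, g⟩ := v
      simp only at hu hv
      subst hu hv hij
      have hfg : f.1 ≠ g.1 := fun h => huv (by rw [Subtype.ext h])
      obtain ⟨i, hi⟩ := Function.ne_iff.mp hfg
      exact ⟨i, i, rfl, hi⟩
    · exact absurd (hu.symm.trans ((congrArg Sigma.fst huv).trans hv)) hij
    · exact ((gr_adj _ _).mp huv).2
  obtain ⟨k, l, hkl, hne⟩ := hconf
  have hne' : v.2.1 l = !(u.2.1 k) := by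
    revert hne
    cases u.2.1 k <;> cases v.2.1 l <;> simp
  have hEu : E i u = jp (Y u.1) u.2.1 := if_pos hu
  have hEv : E j v = jp (Y v.1) v.2.1 := if_pos hv
  rw [hEu, hEv]
  calc (jp (Y u.1) u.2.1 * jp (Y v.1) v.2.1).trace.re ≤ (prj (Y u.1 k) (u.2.1 k) * prj (Y v.1 l) (v.2.1 l)).trace.re :=
        trace_mono (hjp _ _) (hjp _ _) ⟨prj_herm (h1 _ _) _, prj_idem (h2 _ _) _⟩
          ⟨prj_herm (h1 _ _) _, prj_idem (h2 _ _) _⟩ (jp_mul (h2 _) (hc _) _ _)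
          (jp_mul (h2 _) (hc _) _ _)
    _ = (prj (Y u.1 k) (u.2.1 k) * prj (Y v.1 l) (!(u.2.1 k))).trace.re := by rw [hne']
    _ ≤ ((Finset.univ.filter fun i => r (vr u.1 k) i ≠ r (vr v.1 l) i).card : ℝ) :=
        trace_prj_le _ _ (hrr _ _) (hrr _ _) _
    _ ≤ D := by exact_mod_cast hD _ _ hkl

end rows

/-! ### Part 8: the permutation model -/

section model

/-- The controlled map. -/
def gf {K : Type} (R S : K → K) (t : Bool × K) : Bool × K :=
  (t.1, if t.1 then S t.2 else R t.2)

lemma gf_gf {K : Type} {R S : K → K} (hR : ∀ k, R (R k) = k) (hS : ∀ k, S (S k) = k)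
    (t : Bool × K) : gf R S (gf R S t) = t := by
  obtain ⟨q, k⟩ := t
  cases q <;> simp [gf, hR, hS]

lemma exists_model (n : ℕ) : ∃ (K : Type) (_ : Fintype K) (_ : DecidableEq K) (R S : K → K)
    (e : Bool × K ≃ Bool × K), (∀ k, R (R k) = k) ∧ (∀ k, S (S k) = k) ∧
    (∀ q k, e (q, R k) = (!(e (q, k)).1, (e (q, k)).2)) ∧
    (Finset.univ.filter fun t : Bool × K => gf R S (e t) ≠ e (t.1, S t.2)).card ≤ 2 ∧
    Fintype.card K = 2 ^ (n + 1) := by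
  induction n with
  | zero =>
    refine ⟨Bool, inferInstance, inferInstance, not, id, Equiv.prodComm _ _, by decide, by decide,
      by decide, by decide, by decide⟩
  | succ n ih =>
    obtain ⟨K, _, _, R, S, e, hR, hS, he, hb, hc⟩ := ih
    let e' : Bool × (Bool × K) ≃ Bool × (Bool × K) :=
      { toFun := fun t => (t.2.1, e (t.1, t.2.2))
        invFun := fun t => ((e.symm t.2).1, t.1, (e.symm t.2).2)
        left_inv := by rintro ⟨q, b, k⟩; simp
        right_inv := by rintro ⟨q, b, k⟩; simp }
    refine ⟨Bool × K, inferInstance, inferInstance, fun t => (!t.1, t.2), gf R S, e', ?_,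
      gf_gf hR hS, ?_, ?_, ?_⟩
    · rintro ⟨q, k⟩; simp
    · rintro q ⟨b, k⟩; rfl
    · refine le_trans (Finset.card_le_card_of_injOn (fun t => (t.1, t.2.2)) ?_ ?_) hb
      · rintro ⟨q, b, k⟩ h
        simp only [Finset.coe_filter, Finset.mem_univ, true_and, Set.mem_setOf_eq] at h ⊢
        cases b
        · exfalso; apply h; simp [e', gf, he]
        · intro h'
          apply h
          simp only [e', Equiv.coe_fn_mk, gf] at h' ⊢
          simp only [if_true]
          rw [← h']
      · rintro ⟨q, b, k⟩ h ⟨q', b', k'⟩ h' hh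
        simp only [Finset.coe_filter, Finset.mem_univ, true_and, Set.mem_setOf_eq] at h h' hh
        cases b
        · exfalso; apply h; simp [e', gf, he]
        cases b'
        · exfalso; apply h'; simp [e', gf, he]
        simp only [Prod.mk.injEq] at hh ⊢
        simp [hh.1, hh.2]
    · rw [Fintype.card_prod, hc, Fintype.card_bool]; ring

variable {K : Type} (R S : K → K) (e : Bool × K ≃ Bool × K)

/-- The signed maps of the model. -/
def rw0 : Vr → (Bool × Bool × Bool × K) → Bool × (Bool × Bool × Bool × K)
  | .X1, (a, b, q, k) => (false, a, b, !q, k)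
  | .Z1, (a, b, q, k) => (q, a, b, q, k)
  | .X2, (a, b, q, k) => (false, !a, b, q, k)
  | .Z2, (a, b, q, k) => (a, a, b, q, k)
  | .X3, (a, b, q, k) => (false, a, !b, q, k)
  | .Z3, (a, b, q, k) => (b, a, b, q, k)
  | .X1X3, (a, b, q, k) => (false, a, !b, !q, k)
  | .Z1Z3, (a, b, q, k) => (xor q b, a, b, q, k)
  | .X1Z3, (a, b, q, k) => (b, a, b, !q, k)
  | .Z1X3, (a, b, q, k) => (q, a, !b, q, k)
  | .P, (a, b, q, k) => (xor q b, a, !b, !q, k)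
  | .X2X3, (a, b, q, k) => (false, !a, !b, q, k)
  | .Z2Z3, (a, b, q, k) => (xor a b, a, b, q, k)
  | .C, (a, b, t) => (false, !a, b, if a then e.symm t else e t)
  | .CX3, (a, b, t) => (false, !a, !b, if a then e.symm t else e t)
  | .Q, (a, b, t) => (xor a b, !a, !b, if a then e.symm t else e t)
  | .R, (a, b, q, k) => (false, a, b, q, R k)
  | .S, (a, b, q, k) => (false, a, b, q, S k)
  | .Sb, (a, b, t) => (false, a, b, e.symm (gf R S (e t)))
  | .Rp, (a, b, q, k) => (false, a, b, q, if q then k else R k)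
  | .Sm, (a, b, q, k) => (false, a, b, q, if q then S k else k)
  | .G, (a, b, t) => (false, a, b, gf R S t)
  | .R2, (a, b, q, k) => (false, a, b, q, if a then k else R k)
  | .V2, (a, b, q, k) => (false, a, b, if a then !q else q, k)
  | .Y1, (a, b, q, k) => (false, a, b, if a then (!q, k) else (q, R k))
  | .S2, (a, b, t) => (false, a, b, if a then t else e.symm (gf R S (e t)))
  | .G2, (a, b, t) => (false, a, b, if a then gf R S t else t)
  | .Y2, (a, b, t) => (false, a, b, if a then gf R S t else e.symm (gf R S (e t)))

lemma model_inv (hR : ∀ k, R (R k) = k) (hS : ∀ k, S (S k) = k) (v : Vr) :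
    rmul (rw0 R S e v) (rw0 R S e v) = rone false := by
  have hG := gf_gf hR hS
  funext ⟨a, b, q, k⟩
  cases v <;> cases a <;> cases q <;> simp [rw0, rmul, rone, hR, hS, hG]

lemma model_symm (he : ∀ q k, e (q, R k) = (!(e (q, k)).1, (e (q, k)).2)) (q : Bool) (k : K) :
    e.symm (!q, k) = ((e.symm (q, k)).1, R (e.symm (q, k)).2) := by
  rw [Equiv.symm_apply_eq, he]
  simp

lemma model_c0 (hR : ∀ k, R (R k) = k) (hS : ∀ k, S (S k) = k) :
    Kd.Lp.RRel (rw0 R S e .X1) (rw0 R S e .X3) (rw0 R S e .X1X3) := by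
  have hG := gf_gf hR hS
  refine ⟨model_inv R S e hR hS _, model_inv R S e hR hS _, model_inv R S e hR hS _,
    ?_, ?_, ?_, ?_⟩
  all_goals (funext ⟨a, b, q, k⟩; cases a <;> cases b <;> cases q <;> simp [rw0, rmul, rone, gf, hR, hS, hG])

lemma model_c1 (hR : ∀ k, R (R k) = k) (hS : ∀ k, S (S k) = k) :
    Kd.Lp.RRel (rw0 R S e .Z1) (rw0 R S e .Z3) (rw0 R S e .Z1Z3) := by
  have hG := gf_gf hR hS
  refine ⟨model_inv R S e hR hS _, model_inv R S e hR hS _, model_inv R S e hR hS _,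
    ?_, ?_, ?_, ?_⟩
  all_goals (funext ⟨a, b, q, k⟩; cases a <;> cases b <;> cases q <;> simp [rw0, rmul, rone, gf, hR, hS, hG])

lemma model_c2 (hR : ∀ k, R (R k) = k) (hS : ∀ k, S (S k) = k) :
    Kd.Lp.RRel (rw0 R S e .X1) (rw0 R S e .Z3) (rw0 R S e .X1Z3) := by
  have hG := gf_gf hR hS
  refine ⟨model_inv R S e hR hS _, model_inv R S e hR hS _, model_inv R S e hR hS _,
    ?_, ?_, ?_, ?_⟩
  all_goals (funext ⟨a, b, q, k⟩; cases a <;> cases b <;> cases q <;> simp [rw0, rmul, rone, gf, hR, hS, hG])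

lemma model_c3 (hR : ∀ k, R (R k) = k) (hS : ∀ k, S (S k) = k) :
    Kd.Lp.RRel (rw0 R S e .Z1) (rw0 R S e .X3) (rw0 R S e .Z1X3) := by
  have hG := gf_gf hR hS
  refine ⟨model_inv R S e hR hS _, model_inv R S e hR hS _, model_inv R S e hR hS _,
    ?_, ?_, ?_, ?_⟩
  all_goals (funext ⟨a, b, q, k⟩; cases a <;> cases b <;> cases q <;> simp [rw0, rmul, rone, gf, hR, hS, hG])

lemma model_c4 (hR : ∀ k, R (R k) = k) (hS : ∀ k, S (S k) = k) :
    Kd.Lp.RRel (rw0 R S e .X1X3) (rw0 R S e .Z1Z3) (rw0 R S e .P) := by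
  have hG := gf_gf hR hS
  refine ⟨model_inv R S e hR hS _, model_inv R S e hR hS _, model_inv R S e hR hS _,
    ?_, ?_, ?_, ?_⟩
  all_goals (funext ⟨a, b, q, k⟩; cases a <;> cases b <;> cases q <;> simp [rw0, rmul, rone, gf, hR, hS, hG])

lemma model_c5 (hR : ∀ k, R (R k) = k) (hS : ∀ k, S (S k) = k) :
    Kd.Lm.RRel (rw0 R S e .X1Z3) (rw0 R S e .Z1X3) (rw0 R S e .P) := by
  have hG := gf_gf hR hS
  refine ⟨model_inv R S e hR hS _, model_inv R S e hR hS _, model_inv R S e hR hS _,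
    ?_, ?_, ?_, ?_⟩
  all_goals (funext ⟨a, b, q, k⟩; cases a <;> cases b <;> cases q <;> simp [rw0, rmul, rone, gf, hR, hS, hG])

lemma model_c6 (hR : ∀ k, R (R k) = k) (hS : ∀ k, S (S k) = k) :
    Kd.Lp.RRel (rw0 R S e .X2) (rw0 R S e .X3) (rw0 R S e .X2X3) := by
  have hG := gf_gf hR hS
  refine ⟨model_inv R S e hR hS _, model_inv R S e hR hS _, model_inv R S e hR hS _,
    ?_, ?_, ?_, ?_⟩
  all_goals (funext ⟨a, b, q, k⟩; cases a <;> cases b <;> cases q <;> simp [rw0, rmul, rone, gf, hR, hS, hG])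

lemma model_c7 (hR : ∀ k, R (R k) = k) (hS : ∀ k, S (S k) = k) :
    Kd.Lp.RRel (rw0 R S e .Z2) (rw0 R S e .Z3) (rw0 R S e .Z2Z3) := by
  have hG := gf_gf hR hS
  refine ⟨model_inv R S e hR hS _, model_inv R S e hR hS _, model_inv R S e hR hS _,
    ?_, ?_, ?_, ?_⟩
  all_goals (funext ⟨a, b, q, k⟩; cases a <;> cases b <;> cases q <;> simp [rw0, rmul, rone, gf, hR, hS, hG])

lemma model_c8 (hR : ∀ k, R (R k) = k) (hS : ∀ k, S (S k) = k) :
    Kd.Fr.RRel (rw0 R S e .X2) (rw0 R S e .Z3) (rw0 R S e .R) := by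
  have hG := gf_gf hR hS
  refine ⟨model_inv R S e hR hS _, model_inv R S e hR hS _, model_inv R S e hR hS _,
    ?_, ?_, ?_, ?_⟩
  · funext ⟨a, b, q, k⟩; cases a <;> cases b <;> cases q <;> simp [rw0, rmul, rone, gf, hR, hS, hG]
  · funext ⟨a, b, q, k⟩; cases a <;> cases b <;> cases q <;> simp [rw0, rmul, rone, gf, hR, hS, hG]
  · funext ⟨a, b, q, k⟩; cases a <;> cases b <;> cases q <;> simp [rw0, rmul, rone, gf, hR, hS, hG]
  · trivial

lemma model_c9 (hR : ∀ k, R (R k) = k) (hS : ∀ k, S (S k) = k) :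
    Kd.Fr.RRel (rw0 R S e .Z1) (rw0 R S e .Z2) (rw0 R S e .X3) := by
  have hG := gf_gf hR hS
  refine ⟨model_inv R S e hR hS _, model_inv R S e hR hS _, model_inv R S e hR hS _,
    ?_, ?_, ?_, ?_⟩
  · funext ⟨a, b, q, k⟩; cases a <;> cases b <;> cases q <;> simp [rw0, rmul, rone, gf, hR, hS, hG]
  · funext ⟨a, b, q, k⟩; cases a <;> cases b <;> cases q <;> simp [rw0, rmul, rone, gf, hR, hS, hG]
  · funext ⟨a, b, q, k⟩; cases a <;> cases b <;> cases q <;> simp [rw0, rmul, rone, gf, hR, hS, hG]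
  · trivial

lemma model_c10 (hR : ∀ k, R (R k) = k) (hS : ∀ k, S (S k) = k) :
    Kd.Fr.RRel (rw0 R S e .X2X3) (rw0 R S e .Z2Z3) (rw0 R S e .R) := by
  have hG := gf_gf hR hS
  refine ⟨model_inv R S e hR hS _, model_inv R S e hR hS _, model_inv R S e hR hS _,
    ?_, ?_, ?_, ?_⟩
  · funext ⟨a, b, q, k⟩; cases a <;> cases b <;> cases q <;> simp [rw0, rmul, rone, gf, hR, hS, hG]
  · funext ⟨a, b, q, k⟩; cases a <;> cases b <;> cases q <;> simp [rw0, rmul, rone, gf, hR, hS, hG]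
  · funext ⟨a, b, q, k⟩; cases a <;> cases b <;> cases q <;> simp [rw0, rmul, rone, gf, hR, hS, hG]
  · trivial

lemma model_c11 (hR : ∀ k, R (R k) = k) (hS : ∀ k, S (S k) = k) :
    Kd.Lp.RRel (rw0 R S e .C) (rw0 R S e .X3) (rw0 R S e .CX3) := by
  have hG := gf_gf hR hS
  refine ⟨model_inv R S e hR hS _, model_inv R S e hR hS _, model_inv R S e hR hS _,
    ?_, ?_, ?_, ?_⟩
  all_goals (funext ⟨a, b, t⟩; cases a <;> cases b <;> simp [rw0, rmul, rone, hG])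

lemma model_c12 (hR : ∀ k, R (R k) = k) (hS : ∀ k, S (S k) = k) :
    Kd.Lp.RRel (rw0 R S e .CX3) (rw0 R S e .Z2Z3) (rw0 R S e .Q) := by
  have hG := gf_gf hR hS
  refine ⟨model_inv R S e hR hS _, model_inv R S e hR hS _, model_inv R S e hR hS _,
    ?_, ?_, ?_, ?_⟩
  all_goals (funext ⟨a, b, t⟩; cases a <;> cases b <;> simp [rw0, rmul, rone, hG])

lemma model_c13 (hR : ∀ k, R (R k) = k) (hS : ∀ k, S (S k) = k) :
    Kd.Tp.RRel (rw0 R S e .Z1) (rw0 R S e .R) (rw0 R S e .Rp) := by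
  have hG := gf_gf hR hS
  refine ⟨model_inv R S e hR hS _, model_inv R S e hR hS _, model_inv R S e hR hS _,
    ?_, ?_, ?_, ?_⟩
  · funext ⟨a, b, q, k⟩; cases a <;> cases b <;> cases q <;> simp [rw0, rmul, rone, gf, hR, hS, hG]
  · funext ⟨a, b, q, k⟩; cases a <;> cases b <;> cases q <;> simp [rw0, rmul, rone, gf, hR, hS, hG]
  · funext ⟨a, b, q, k⟩; cases a <;> cases b <;> cases q <;> simp [rw0, rmul, rone, gf, hR, hS, hG]
  · rintro ⟨a, b, q, k⟩; cases a <;> cases q <;> simp [rw0]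

lemma model_c14 (hR : ∀ k, R (R k) = k) (hS : ∀ k, S (S k) = k) :
    Kd.Tm.RRel (rw0 R S e .Z1) (rw0 R S e .S) (rw0 R S e .Sm) := by
  have hG := gf_gf hR hS
  refine ⟨model_inv R S e hR hS _, model_inv R S e hR hS _, model_inv R S e hR hS _,
    ?_, ?_, ?_, ?_⟩
  · funext ⟨a, b, q, k⟩; cases a <;> cases b <;> cases q <;> simp [rw0, rmul, rone, gf, hR, hS, hG]
  · funext ⟨a, b, q, k⟩; cases a <;> cases b <;> cases q <;> simp [rw0, rmul, rone, gf, hR, hS, hG]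
  · funext ⟨a, b, q, k⟩; cases a <;> cases b <;> cases q <;> simp [rw0, rmul, rone, gf, hR, hS, hG]
  · rintro ⟨a, b, q, k⟩; cases a <;> cases q <;> simp [rw0]

lemma model_c15 (hR : ∀ k, R (R k) = k) (hS : ∀ k, S (S k) = k) :
    Kd.Lp.RRel (rw0 R S e .Rp) (rw0 R S e .Sm) (rw0 R S e .G) := by
  have hG := gf_gf hR hS
  refine ⟨model_inv R S e hR hS _, model_inv R S e hR hS _, model_inv R S e hR hS _,
    ?_, ?_, ?_, ?_⟩
  all_goals (funext ⟨a, b, q, k⟩; cases a <;> cases b <;> cases q <;> simp [rw0, rmul, rone, gf, hR, hS, hG])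

lemma model_c16 (hR : ∀ k, R (R k) = k) (hS : ∀ k, S (S k) = k) :
    Kd.Tp.RRel (rw0 R S e .Z2) (rw0 R S e .R) (rw0 R S e .R2) := by
  have hG := gf_gf hR hS
  refine ⟨model_inv R S e hR hS _, model_inv R S e hR hS _, model_inv R S e hR hS _,
    ?_, ?_, ?_, ?_⟩
  · funext ⟨a, b, q, k⟩; cases a <;> cases b <;> cases q <;> simp [rw0, rmul, rone, gf, hR, hS, hG]
  · funext ⟨a, b, q, k⟩; cases a <;> cases b <;> cases q <;> simp [rw0, rmul, rone, gf, hR, hS, hG]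
  · funext ⟨a, b, q, k⟩; cases a <;> cases b <;> cases q <;> simp [rw0, rmul, rone, gf, hR, hS, hG]
  · rintro ⟨a, b, q, k⟩; cases a <;> cases q <;> simp [rw0]

lemma model_c17 (hR : ∀ k, R (R k) = k) (hS : ∀ k, S (S k) = k) :
    Kd.Tm.RRel (rw0 R S e .Z2) (rw0 R S e .X1) (rw0 R S e .V2) := by
  have hG := gf_gf hR hS
  refine ⟨model_inv R S e hR hS _, model_inv R S e hR hS _, model_inv R S e hR hS _,
    ?_, ?_, ?_, ?_⟩
  · funext ⟨a, b, q, k⟩; cases a <;> cases b <;> cases q <;> simp [rw0, rmul, rone, gf, hR, hS, hG]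
  · funext ⟨a, b, q, k⟩; cases a <;> cases b <;> cases q <;> simp [rw0, rmul, rone, gf, hR, hS, hG]
  · funext ⟨a, b, q, k⟩; cases a <;> cases b <;> cases q <;> simp [rw0, rmul, rone, gf, hR, hS, hG]
  · rintro ⟨a, b, q, k⟩; cases a <;> cases q <;> simp [rw0]

lemma model_c18 (hR : ∀ k, R (R k) = k) (hS : ∀ k, S (S k) = k) :
    Kd.Lp.RRel (rw0 R S e .R2) (rw0 R S e .V2) (rw0 R S e .Y1) := by
  have hG := gf_gf hR hS
  refine ⟨model_inv R S e hR hS _, model_inv R S e hR hS _, model_inv R S e hR hS _,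
    ?_, ?_, ?_, ?_⟩
  all_goals (funext ⟨a, b, q, k⟩; cases a <;> cases b <;> cases q <;> simp [rw0, rmul, rone, gf, hR, hS, hG])

lemma model_c19 (hR : ∀ k, R (R k) = k) (hS : ∀ k, S (S k) = k) :
    Kd.Tp.RRel (rw0 R S e .Z2) (rw0 R S e .Sb) (rw0 R S e .S2) := by
  have hG := gf_gf hR hS
  refine ⟨model_inv R S e hR hS _, model_inv R S e hR hS _, model_inv R S e hR hS _,
    ?_, ?_, ?_, ?_⟩
  · funext ⟨a, b, t⟩; cases a <;> cases b <;> simp [rw0, rmul, rone, hG]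
  · funext ⟨a, b, t⟩; cases a <;> cases b <;> simp [rw0, rmul, rone, hG]
  · funext ⟨a, b, t⟩; cases a <;> cases b <;> simp [rw0, rmul, rone, hG]
  · rintro ⟨a, b, q, k⟩; cases a <;> cases q <;> simp [rw0]

lemma model_c20 (hR : ∀ k, R (R k) = k) (hS : ∀ k, S (S k) = k) :
    Kd.Tm.RRel (rw0 R S e .Z2) (rw0 R S e .G) (rw0 R S e .G2) := by
  have hG := gf_gf hR hS
  refine ⟨model_inv R S e hR hS _, model_inv R S e hR hS _, model_inv R S e hR hS _,
    ?_, ?_, ?_, ?_⟩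
  · funext ⟨a, b, t⟩; cases a <;> cases b <;> simp [rw0, rmul, rone, hG]
  · funext ⟨a, b, t⟩; cases a <;> cases b <;> simp [rw0, rmul, rone, hG]
  · funext ⟨a, b, t⟩; cases a <;> cases b <;> simp [rw0, rmul, rone, hG]
  · rintro ⟨a, b, q, k⟩; cases a <;> cases q <;> simp [rw0]

lemma model_c21 (hR : ∀ k, R (R k) = k) (hS : ∀ k, S (S k) = k) :
    Kd.Lp.RRel (rw0 R S e .S2) (rw0 R S e .G2) (rw0 R S e .Y2) := by
  have hG := gf_gf hR hS
  refine ⟨model_inv R S e hR hS _, model_inv R S e hR hS _, model_inv R S e hR hS _,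
    ?_, ?_, ?_, ?_⟩
  all_goals (funext ⟨a, b, t⟩; cases a <;> cases b <;> simp [rw0, rmul, rone, hG])

lemma model_c22 (hR : ∀ k, R (R k) = k) (hS : ∀ k, S (S k) = k)
    (he : ∀ q k, e (q, R k) = (!(e (q, k)).1, (e (q, k)).2)) :
    Kd.Fr.RRel (rw0 R S e .C) (rw0 R S e .Y1) (rw0 R S e .Z3) := by
  have hG := gf_gf hR hS
  have he' := model_symm R e he
  have he1 : ∀ t : Bool × K, (!(e t).1, (e t).2) = e (t.1, R t.2) := fun t => (he t.1 t.2).symm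
  have he2 : ∀ t : Bool × K, e.symm (!t.1, t.2) = ((e.symm t).1, R (e.symm t).2) :=
    fun t => he' t.1 t.2
  refine ⟨model_inv R S e hR hS _, model_inv R S e hR hS _, model_inv R S e hR hS _,
    ?_, ?_, ?_, ?_⟩
  · funext ⟨a, b, t⟩; cases a <;> cases b <;> simp [rw0, rmul, rone, he1, he2]
  · funext ⟨a, b, t⟩; cases a <;> cases b <;> simp [rw0, rmul, rone, he1, he2]
  · funext ⟨a, b, t⟩; cases a <;> cases b <;> simp [rw0, rmul, rone, he1, he2]
  · trivial

lemma model_c23 (hR : ∀ k, R (R k) = k) (hS : ∀ k, S (S k) = k) :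
    Kd.Fr.RRel (rw0 R S e .C) (rw0 R S e .Y2) (rw0 R S e .Z3) := by
  have hG := gf_gf hR hS
  refine ⟨model_inv R S e hR hS _, model_inv R S e hR hS _, model_inv R S e hR hS _,
    ?_, ?_, ?_, ?_⟩
  · funext ⟨a, b, t⟩; cases a <;> cases b <;> simp [rw0, rmul, rone, hG]
  · funext ⟨a, b, t⟩; cases a <;> cases b <;> simp [rw0, rmul, rone, hG]
  · funext ⟨a, b, t⟩; cases a <;> cases b <;> simp [rw0, rmul, rone, hG]
  · trivial

lemma model_c24 (hR : ∀ k, R (R k) = k) (hS : ∀ k, S (S k) = k) :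
    Kd.Fr.RRel (rw0 R S e .X1) (rw0 R S e .R) (rw0 R S e .X2) := by
  have hG := gf_gf hR hS
  refine ⟨model_inv R S e hR hS _, model_inv R S e hR hS _, model_inv R S e hR hS _,
    ?_, ?_, ?_, ?_⟩
  · funext ⟨a, b, q, k⟩; cases a <;> cases b <;> cases q <;> simp [rw0, rmul, rone, gf, hR, hS, hG]
  · funext ⟨a, b, q, k⟩; cases a <;> cases b <;> cases q <;> simp [rw0, rmul, rone, gf, hR, hS, hG]
  · funext ⟨a, b, q, k⟩; cases a <;> cases b <;> cases q <;> simp [rw0, rmul, rone, gf, hR, hS, hG]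
  · trivial

lemma model_c25 (hR : ∀ k, R (R k) = k) (hS : ∀ k, S (S k) = k) :
    Kd.Fr.RRel (rw0 R S e .X1) (rw0 R S e .S) (rw0 R S e .X2) := by
  have hG := gf_gf hR hS
  refine ⟨model_inv R S e hR hS _, model_inv R S e hR hS _, model_inv R S e hR hS _,
    ?_, ?_, ?_, ?_⟩
  · funext ⟨a, b, q, k⟩; cases a <;> cases b <;> cases q <;> simp [rw0, rmul, rone, gf, hR, hS, hG]
  · funext ⟨a, b, q, k⟩; cases a <;> cases b <;> cases q <;> simp [rw0, rmul, rone, gf, hR, hS, hG]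
  · funext ⟨a, b, q, k⟩; cases a <;> cases b <;> cases q <;> simp [rw0, rmul, rone, gf, hR, hS, hG]
  · trivial

lemma model_rel (hR : ∀ k, R (R k) = k) (hS : ∀ k, S (S k) = k)
    (he : ∀ q k, e (q, R k) = (!(e (q, k)).1, (e (q, k)).2)) (c : Fin nC) :
    (kd c).RRel (rw0 R S e (vr c 0)) (rw0 R S e (vr c 1)) (rw0 R S e (vr c 2)) := by
  fin_cases c
  · exact model_c0 R S e hR hS
  · exact model_c1 R S e hR hS
  · exact model_c2 R S e hR hS
  · exact model_c3 R S e hR hS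
  · exact model_c4 R S e hR hS
  · exact model_c5 R S e hR hS
  · exact model_c6 R S e hR hS
  · exact model_c7 R S e hR hS
  · exact model_c8 R S e hR hS
  · exact model_c9 R S e hR hS
  · exact model_c10 R S e hR hS
  · exact model_c11 R S e hR hS
  · exact model_c12 R S e hR hS
  · exact model_c13 R S e hR hS
  · exact model_c14 R S e hR hS
  · exact model_c15 R S e hR hS
  · exact model_c16 R S e hR hS
  · exact model_c17 R S e hR hS
  · exact model_c18 R S e hR hS
  · exact model_c19 R S e hR hS
  · exact model_c20 R S e hR hS
  · exact model_c21 R S e hR hS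
  · exact model_c22 R S e hR hS he
  · exact model_c23 R S e hR hS
  · exact model_c24 R S e hR hS
  · exact model_c25 R S e hR hS

end model

/-! ### Part 9: conclusion -/

lemma perfectQA_gr : PerfectQA (indepLose gr nC) := by
  apply perfectQA_of_approx
  intro n
  obtain ⟨K, _, _, R, S, e, hR, hS, he, hb, hc⟩ := exists_model n
  have : Nonempty K := by
    rw [← Fintype.card_pos_iff, hc]; positivity
  have hbad : (Finset.univ.filter fun i => rw0 R S e .S i ≠ rw0 R S e .Sb i).card ≤ 8 := by
    calc _ ≤ (Finset.univ ×ˢ (Finset.univ ×ˢ (Finset.univ.filter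
          fun t : Bool × K => gf R S (e t) ≠ e (t.1, S t.2))) :
            Finset (Bool × Bool × Bool × K)).card := by
          apply Finset.card_le_card
          rintro ⟨a, b, q, k⟩ h
          simp only [Finset.mem_filter, Finset.mem_univ, true_and, Finset.mem_product] at h ⊢
          intro h'
          apply h
          simp [rw0, h']
      _ ≤ 8 := by
          rw [Finset.card_product, Finset.card_product]
          simp only [Finset.card_univ, Fintype.card_bool]
          omega
  obtain ⟨p, hp, hI, hl⟩ := completeness (rw0 R S e) 8 (model_rel R S e hR hS he) (by
    intro v w hvw
    by_cases h : v = w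
    · subst h; simp
    · have : (v = .S ∧ w = .Sb) ∨ (v = .Sb ∧ w = .S) := by
        cases v <;> cases w <;> first
          | exact absurd rfl h
          | exact Or.inl ⟨rfl, rfl⟩
          | exact Or.inr ⟨rfl, rfl⟩
          | cases hvw
      rcases this with ⟨rfl, rfl⟩ | ⟨rfl, rfl⟩
      · exact hbad
      · simpa only [ne_comm] using hbad)
  refine ⟨p, hp, hI, fun x y a b h => (hl x y a b h).trans ?_⟩
  have hcard : (Fintype.card (Bool × Bool × Bool × K) : ℝ) = 16 * 2 ^ n := by
    rw [Fintype.card_prod, Fintype.card_prod, Fintype.card_prod, hc, Fintype.card_bool]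
    push_cast; ring
  have h2 : (n : ℝ) + 1 ≤ 2 ^ n := by exact_mod_cast Nat.lt_two_pow_self
  rw [hcard, div_le_div_iff₀ (by positivity) (by positivity)]
  push_cast
  nlinarith

/-- There is a finite graph `G` with `α_q(G) < α_qa(G)`. -/
theorem exists_graph_alphaQ_lt_alphaQA :
    ∃ (V : Type) (_inst : Fintype V) (G : SimpleGraph V),
      @alphaQ V _inst G < @alphaQA V _inst G := by
  refine ⟨Vx, inferInstance, gr, ?_⟩
  have h1 : nC ≤ alphaQA gr :=
    le_csSup ⟨Fintype.card Vx, fun c hc => perfectQA_le gr c hc⟩ perfectQA_gr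
  have h2 : ∀ c ∈ {c : ℕ | PerfectQ (indepLose gr c)}, c ≤ nC - 1 := by
    intro c hc
    by_contra hlt
    exact not_perfectQ (perfectQ_mono gr (by simp only [nC] at hlt ⊢; omega) hc)
  have h3 : alphaQ gr ≤ nC - 1 := csSup_le' h2
  refine lt_of_le_of_lt h3 (lt_of_lt_of_le ?_ h1)
  simp [nC]
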